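/- arXiv:1807.07549 — 3 statements merged into one kernel-verified Lean document; each statement's English description precedes it below -/
import Mathlib

section
/- Proposition 1 (log-gas representation of the boundary generating function). Let N, r, s be positive integers with r+s ≤ N, let α ∈ (0,1), and let w > 0 with w ≠ 1, and set u = (αw+1−α)/w. Then F_{N,r,s}(w)/F_{N,r,s}(1) = w^{r−1} · I_{N,r,s}(u)/I_{N,r,s}(1), where I_{N,r,s}(u) = Σ_{m_1,…,m_s=0}^{r−1} ∏_{j=1}^{s} α^{m_j}·C(N−r−s+m_j, N−r−s) · ∏_{1≤j<k≤s}(m_k−m_j)^2 · (1/(2πi))∮ σ(u,z)/∏_{j=1}^{s}(z−m_j) dz with σ(u,z) = (s−1)!·u^{r+s−z−2}/(1−u)^{s−1} (here u^{r+s−z−2} := exp((r+s−z−2)·log u)), the contour being a counterclockwise circle enclosing the points 0,1,…,r−1, and I_{N,r,s}(1) = Σ_{m_1,…,m_s=0}^{r−1} ∏_{j=1}^{s} α^{m_j}·C(N−r−s+m_j, N−r−s) · ∏_{1≤j<k≤s}(m_k−m_j)^2. -/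
/-- Iterated counterclockwise contour integral over `n` copies of the circle of
radius `ρ` centered at the origin (without the `1/(2πi)` normalisation). -/
noncomputable def circIntN : (n : ℕ) → ℝ → ((Fin n → ℂ) → ℂ) → ℂ
  | 0, _, f => f (fun i => i.elim0)
  | n + 1, ρ, f => ∮ z in C(0, ρ), circIntN n ρ (fun v => f (Fin.cons z v))

/-- The generalized emptiness formation probability `G_{N,s}^{(r_1,…,r_s)}` of the
free-fermion six-vertex model with domain wall boundary conditions, given by the
`s`-fold contour integral over circles of radius `ρ` centered at the origin. -/
noncomputable def gefp (N s : ℕ) (α : ℝ) (rv : Fin s → ℕ) (ρ : ℝ) : ℂ :=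
  (-1 : ℂ) ^ s * ((2 * Real.pi * Complex.I) ^ s)⁻¹ *
    circIntN s ρ (fun z =>
      (∏ j : Fin s, ((α : ℂ) * z j + 1 - (α : ℂ)) ^ (N - 1 - (j : ℕ)) /
        ((z j) ^ (rv j) * (z j - 1) ^ (s - (j : ℕ)))) *
      ∏ j : Fin s, ∏ k ∈ Finset.Ioi j, (z j - z k))

/-- The boundary generating function
`F_{N,r,s}(w) = Σ_{r_1=1}^{r} (G^{(r_1,r,…,r)} − G^{(r_1−1,r,…,r)}) w^{r_1−1}`. -/
noncomputable def bgf (N r s : ℕ) (α ρ : ℝ) (w : ℝ) : ℂ :=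
  ∑ r1 ∈ Finset.Icc 1 r,
    (gefp N s α (fun j => if (j : ℕ) = 0 then r1 else r) ρ -
      gefp N s α (fun j => if (j : ℕ) = 0 then r1 - 1 else r) ρ) * (w : ℂ) ^ (r1 - 1)

/-- `σ(u,z) = (s−1)! · u^{r+s−z−2} / (1−u)^{s−1}`, where
`u^{r+s−z−2} := exp((r+s−z−2)·log u)`. -/
noncomputable def sigmaFn (r s : ℕ) (u : ℝ) (z : ℂ) : ℂ :=
  ((s - 1).factorial : ℂ) *
    Complex.exp (((r : ℂ) + (s : ℂ) - z - 2) * (Real.log u : ℂ)) /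
    (1 - (u : ℂ)) ^ (s - 1)

/-- The refined log-gas quantity
`I_{N,r,s}(u) = Σ_{m_1,…,m_s=0}^{r−1} ∏_j α^{m_j} C(N−r−s+m_j, N−r−s)
  · ∏_{j<k}(m_k−m_j)^2 · (1/(2πi)) ∮ σ(u,z)/∏_j(z−m_j) dz`,
with contour a counterclockwise circle of radius `ρ` centered at the origin. -/
noncomputable def loggasI (N r s : ℕ) (α u ρ : ℝ) : ℂ :=
  ∑ m : Fin s → Fin r,
    (∏ j : Fin s, (α : ℂ) ^ ((m j : ℕ)) *
        ((N - r - s + (m j : ℕ)).choose (N - r - s) : ℂ)) *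
    (∏ j : Fin s, ∏ k ∈ Finset.Ioi j, (((m k : ℕ) : ℂ) - ((m j : ℕ) : ℂ)) ^ 2) *
    ((2 * Real.pi * Complex.I)⁻¹ *
      ∮ z in C(0, ρ), sigmaFn r s u z / ∏ j : Fin s, (z - ((m j : ℕ) : ℂ)))

/-- The log-gas partition function
`I_{N,r,s}(1) = Σ_{m_1,…,m_s=0}^{r−1} ∏_j α^{m_j} C(N−r−s+m_j, N−r−s)
  · ∏_{j<k}(m_k−m_j)^2`. -/
noncomputable def loggasI1 (N r s : ℕ) (α : ℝ) : ℝ :=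
  ∑ m : Fin s → Fin r,
    (∏ j : Fin s, α ^ ((m j : ℕ)) *
        ((N - r - s + (m j : ℕ)).choose (N - r - s) : ℝ)) *
    (∏ j : Fin s, ∏ k ∈ Finset.Ioi j, (((m k : ℕ) : ℝ) - ((m j : ℕ) : ℝ)) ^ 2)

open Finset in
theorem circIntN_sum_mul_prod {ι : Type*} [Fintype ι] (n : ℕ) {ρ : ℝ} (hρ : 0 ≤ ρ)
    (c : ι → ℂ) (g : ι → Fin n → ℂ → ℂ)
    (hg : ∀ i j, ContinuousOn (g i j) (Metric.sphere 0 ρ)) :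
    circIntN n ρ (fun z => ∑ i, c i * ∏ j, g i j (z j)) =
      ∑ i, c i * ∏ j, ∮ z in C(0, ρ), g i j z := by
  induction n generalizing c with
  | zero => simp [circIntN]
  | succ n ih =>
    have h : ∀ z : ℂ, circIntN n ρ (fun v => ∑ i, c i * ∏ j, g i j
          ((Fin.cons z v : Fin (n + 1) → ℂ) j)) =
        ∑ i, c i * (∏ j : Fin n, ∮ x in C(0, ρ), g i j.succ x) * g i 0 z := by
      intro z
      have := ih (fun i => c i * g i 0 z) (fun i j => g i j.succ) (fun i j => hg i j.succ)
      simp only [Fin.prod_univ_succ, Fin.cons_zero, Fin.cons_succ, ← mul_assoc] at this ⊢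
      rw [this]
      exact sum_congr rfl fun i _ => by ring
    simp only [circIntN, h]
    have hint : ∀ i ∈ univ, CircleIntegrable
        (fun z => c i * (∏ j : Fin n, ∮ x in C(0, ρ), g i j.succ x) * g i 0 z) 0 ρ :=
      fun i _ => (continuousOn_const.mul (hg i 0)).circleIntegrable hρ
    rw [circleIntegral.integral_fun_sum hint]
    refine sum_congr rfl fun i _ => ?_
    rw [circleIntegral.integral_const_mul, Fin.prod_univ_succ]
    ring

/-- The normalised contour integral of `(α z + 1 - α) ^ M / (z ^ n * (z - 1) ^ a)`. -/
noncomputable def contourCoeff (α ρ : ℝ) (n M a : ℕ) : ℂ :=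
  (2 * Real.pi * Complex.I)⁻¹ *
    ∮ z in C(0, ρ), ((α : ℂ) * z + 1 - α) ^ M / (z ^ n * (z - 1) ^ a)

section contourCoeff

variable {α ρ : ℝ}

theorem ne_zero_of_mem_contour (hρ : ρ ∈ Set.Ioo (0 : ℝ) 1) {z : ℂ}
    (hz : z ∈ Metric.sphere (0 : ℂ) ρ) : z ≠ 0 := by
  rintro rfl
  simp at hz
  exact hρ.1.ne hz

theorem sub_one_ne_zero_of_mem_disc (hρ : ρ ∈ Set.Ioo (0 : ℝ) 1) {z : ℂ}
    (hz : z ∈ Metric.closedBall (0 : ℂ) ρ) : z - 1 ≠ 0 := by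
  intro h
  rw [sub_eq_zero] at h
  subst h
  simp at hz
  linarith [hρ.2]

theorem continuousOn_contour_integrand (hρ : ρ ∈ Set.Ioo (0 : ℝ) 1) (n M a l : ℕ) :
    ContinuousOn (fun z : ℂ => ((α : ℂ) * z + 1 - α) ^ M / (z ^ n * (z - 1) ^ a) * z ^ l)
      (Metric.sphere 0 ρ) := by
  refine ContinuousOn.mul (ContinuousOn.div (by fun_prop) (by fun_prop) fun z hz => ?_)
    (by fun_prop)
  exact mul_ne_zero (pow_ne_zero _ (ne_zero_of_mem_contour hρ hz))
    (pow_ne_zero _ (sub_one_ne_zero_of_mem_disc hρ (Metric.sphere_subset_closedBall hz)))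

theorem circleIntegrable_contour_integrand (hρ : ρ ∈ Set.Ioo (0 : ℝ) 1) (n M a : ℕ) :
    CircleIntegrable (fun z : ℂ => ((α : ℂ) * z + 1 - α) ^ M / (z ^ n * (z - 1) ^ a)) 0 ρ := by
  have := (continuousOn_contour_integrand (α := α) hρ n M a 0).circleIntegrable hρ.1.le
  simpa using this

theorem circleIntegral_regular_eq_zero (hρ : ρ ∈ Set.Ioo (0 : ℝ) 1) (M a l : ℕ) :
    (∮ z in C(0, ρ), ((α : ℂ) * z + 1 - α) ^ M / (z - 1) ^ a * z ^ l) = 0 := by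
  have hd : DifferentiableOn ℂ
      (fun z : ℂ => ((α : ℂ) * z + 1 - α) ^ M / (z - 1) ^ a * z ^ l) (Metric.closedBall 0 ρ) := by
    refine DifferentiableOn.mul (DifferentiableOn.div (by fun_prop) (by fun_prop)
      fun z hz => pow_ne_zero _ (sub_one_ne_zero_of_mem_disc hρ hz)) (by fun_prop)
  exact Complex.circleIntegral_eq_zero_of_differentiable_on_off_countable hρ.1.le
    Set.countable_empty hd.continuousOn fun z hz =>
      (hd z (Metric.ball_subset_closedBall hz.1)).differentiableAt
        (Metric.closedBall_mem_nhds_of_mem hz.1)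

theorem contourCoeff_zero (hρ : ρ ∈ Set.Ioo (0 : ℝ) 1) (M a : ℕ) :
    contourCoeff α ρ 0 M a = 0 := by
  have := circleIntegral_regular_eq_zero (α := α) hρ M a 0
  simp only [pow_zero, mul_one] at this
  simp [contourCoeff, this]

theorem circleIntegral_mul_pow (hρ : ρ ∈ Set.Ioo (0 : ℝ) 1) (p M a l : ℕ) :
    (∮ z in C(0, ρ), ((α : ℂ) * z + 1 - α) ^ M / (z ^ p * (z - 1) ^ a) * z ^ l) =
      2 * Real.pi * Complex.I * contourCoeff α ρ (p - l) M a := by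
  have h2 : (2 * Real.pi * Complex.I : ℂ) ≠ 0 := Complex.two_pi_I_ne_zero
  rcases le_total l p with h | h
  · obtain ⟨k, rfl⟩ := Nat.exists_eq_add_of_le h
    rw [contourCoeff, mul_inv_cancel_left₀ h2]
    refine circleIntegral.integral_congr hρ.1.le fun z hz => ?_
    have h0 := ne_zero_of_mem_contour hρ hz
    simp only [Nat.add_sub_cancel_left, pow_add]
    field_simp
  · obtain ⟨k, rfl⟩ := Nat.exists_eq_add_of_le h
    rw [Nat.sub_eq_zero_of_le h, contourCoeff_zero hρ, mul_zero]
    refine Eq.trans ?_ (circleIntegral_regular_eq_zero (α := α) hρ M a k)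
    refine circleIntegral.integral_congr hρ.1.le fun z hz => ?_
    have h0 := ne_zero_of_mem_contour hρ hz
    simp only [pow_add]
    field_simp

theorem contourCoeff_succ_succ (hρ : ρ ∈ Set.Ioo (0 : ℝ) 1) (n M a : ℕ) :
    contourCoeff α ρ (n + 1) (M + 1) a =
      (1 - α) * contourCoeff α ρ (n + 1) M a + α * contourCoeff α ρ n M a := by
  have h : (∮ z in C(0, ρ), ((α : ℂ) * z + 1 - α) ^ (M + 1) / (z ^ (n + 1) * (z - 1) ^ a)) =
      ∮ z in C(0, ρ), ((1 - α : ℂ) * (((α : ℂ) * z + 1 - α) ^ M / (z ^ (n + 1) * (z - 1) ^ a)) +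
        α * (((α : ℂ) * z + 1 - α) ^ M / (z ^ n * (z - 1) ^ a))) := by
    refine circleIntegral.integral_congr hρ.1.le fun z hz => ?_
    have h0 := ne_zero_of_mem_contour hρ hz
    have h1 := sub_one_ne_zero_of_mem_disc hρ (Metric.sphere_subset_closedBall hz)
    simp only [pow_succ]
    field_simp
    ring
  have hint : ∀ (c : ℂ) (k : ℕ), CircleIntegrable
      (fun z : ℂ => c * (((α : ℂ) * z + 1 - α) ^ M / (z ^ k * (z - 1) ^ a))) 0 ρ :=
    fun c k => (circleIntegrable_contour_integrand hρ k M a).const_smul (a := c)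
  rw [contourCoeff, h, circleIntegral.integral_add (hint _ _) (hint _ _),
    circleIntegral.integral_const_mul, circleIntegral.integral_const_mul]
  simp only [contourCoeff]
  ring

theorem contourCoeff_sub (hρ : ρ ∈ Set.Ioo (0 : ℝ) 1) (n M a : ℕ) :
    contourCoeff α ρ n M (a + 1) - contourCoeff α ρ (n + 1) M (a + 1) =
      contourCoeff α ρ (n + 1) M a := by
  have h : (∮ z in C(0, ρ), ((α : ℂ) * z + 1 - α) ^ M / (z ^ (n + 1) * (z - 1) ^ a)) =
      ∮ z in C(0, ρ), (((α : ℂ) * z + 1 - α) ^ M / (z ^ n * (z - 1) ^ (a + 1)) -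
        ((α : ℂ) * z + 1 - α) ^ M / (z ^ (n + 1) * (z - 1) ^ (a + 1))) := by
    refine circleIntegral.integral_congr hρ.1.le fun z hz => ?_
    have h0 := ne_zero_of_mem_contour hρ hz
    have h1 := sub_one_ne_zero_of_mem_disc hρ (Metric.sphere_subset_closedBall hz)
    simp only [pow_succ]
    field_simp
  simp only [contourCoeff]
  rw [h, circleIntegral.integral_sub (circleIntegrable_contour_integrand hρ _ _ _)
    (circleIntegrable_contour_integrand hρ _ _ _)]
  ring

theorem contourCoeff_succ_zero (hρ : ρ ∈ Set.Ioo (0 : ℝ) 1) (n M : ℕ) :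
    contourCoeff α ρ (n + 1) M 0 = M.choose n * (α : ℂ) ^ n * (1 - α) ^ (M - n) := by
  induction M generalizing n with
  | zero =>
    cases n with
    | zero =>
      have := circleIntegral.integral_sub_center_inv 0 hρ.1.ne'
      simp only [sub_zero] at this
      have h2 := inv_mul_cancel₀ Complex.two_pi_I_ne_zero
      simpa [contourCoeff, this] using h2
    | succ n =>
      have := circleIntegral.integral_sub_zpow_of_ne (n := -((n : ℤ) + 2)) (by omega) 0 0 ρ
      simp only [sub_zero, zpow_neg] at this
      norm_cast at this
      simp [contourCoeff, this]
  | succ M ih =>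
    rw [contourCoeff_succ_succ hρ, ih]
    cases n with
    | zero => simp [contourCoeff_zero hρ, pow_succ]; ring
    | succ n =>
      rw [ih, Nat.choose_succ_succ]
      rcases lt_or_ge n M with h | h
      · obtain ⟨k, rfl⟩ := Nat.exists_eq_add_of_lt h
        rw [show n + k + 1 - (n + 1) = k by omega, show n + k + 1 - n = k + 1 by omega,
          show n + k + 1 + 1 - (n + 1) = k + 1 by omega]
        push_cast
        ring
      · rw [Nat.choose_eq_zero_of_lt (show M < n + 1 by omega), Nat.add_sub_add_right]
        push_cast
        ring

end contourCoeff

section determinants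

variable {α ρ : ℝ}

open Finset Matrix

theorem gefp_eq_det (hρ : ρ ∈ Set.Ioo (0 : ℝ) 1) (N s : ℕ) (rv : Fin s → ℕ) :
    gefp N s α rv ρ = ((-1) ^ s * ∏ j : Fin s, ∏ _k ∈ Ioi j, (-1 : ℂ)) *
      det (of fun j l : Fin s =>
        contourCoeff α ρ (rv j - (l : ℕ)) (N - 1 - (j : ℕ)) (s - (j : ℕ))) := by
  set ε : ℂ := ∏ j : Fin s, ∏ _k ∈ Ioi j, (-1 : ℂ)
  have hΔ : ∀ z : Fin s → ℂ, ∏ j : Fin s, ∏ k ∈ Ioi j, (z j - z k) =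
      ∑ σ : Equiv.Perm (Fin s), ε * ((Equiv.Perm.sign σ : ℤ) : ℂ) *
        ∏ j, z j ^ ((σ j : Fin s) : ℕ) := by
    intro z
    have h : ∏ j : Fin s, ∏ k ∈ Ioi j, (z j - z k) = ε * det (vandermonde z) := by
      rw [det_vandermonde, ← prod_mul_distrib]
      refine prod_congr rfl fun j _ => ?_
      rw [← prod_mul_distrib]
      exact prod_congr rfl fun k _ => by ring
    rw [h, ← det_transpose, det_apply', mul_sum]
    refine sum_congr rfl fun σ _ => ?_
    simp [vandermonde_apply, mul_assoc]
  have hint : ∀ z : Fin s → ℂ,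
      (∏ j : Fin s, ((α : ℂ) * z j + 1 - (α : ℂ)) ^ (N - 1 - (j : ℕ)) /
        ((z j) ^ (rv j) * (z j - 1) ^ (s - (j : ℕ)))) *
        ∏ j : Fin s, ∏ k ∈ Ioi j, (z j - z k) =
      ∑ σ : Equiv.Perm (Fin s), ε * ((Equiv.Perm.sign σ : ℤ) : ℂ) *
        ∏ j, (((α : ℂ) * z j + 1 - (α : ℂ)) ^ (N - 1 - (j : ℕ)) /
          ((z j) ^ (rv j) * (z j - 1) ^ (s - (j : ℕ))) * z j ^ ((σ j : Fin s) : ℕ)) := by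
    intro z
    rw [hΔ, mul_sum]
    refine sum_congr rfl fun σ _ => ?_
    rw [prod_mul_distrib]
    ring
  have h2 : (2 * Real.pi * Complex.I : ℂ) ^ s ≠ 0 := pow_ne_zero _ Complex.two_pi_I_ne_zero
  simp only [gefp, hint]
  rw [circIntN_sum_mul_prod s hρ.1.le
    (fun σ : Equiv.Perm (Fin s) => ε * ((Equiv.Perm.sign σ : ℤ) : ℂ))
    (fun σ j z => ((α : ℂ) * z + 1 - (α : ℂ)) ^ (N - 1 - (j : ℕ)) /
          (z ^ (rv j) * (z - 1) ^ (s - (j : ℕ))) * z ^ ((σ j : Fin s) : ℕ))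
    (fun σ j => continuousOn_contour_integrand hρ _ _ _ _)]
  simp only [circleIntegral_mul_pow hρ, prod_mul_distrib, prod_const, card_univ, Fintype.card_fin]
  rw [← det_transpose, det_apply', mul_sum, mul_sum]
  refine sum_congr rfl fun σ _ => ?_
  simp only [transpose_apply, of_apply, ← mul_pow]
  generalize (2 * Real.pi * Complex.I : ℂ) ^ s = T at h2 ⊢
  field_simp

theorem bgf_eq_det (hρ : ρ ∈ Set.Ioo (0 : ℝ) 1) (N r t : ℕ) (w : ℝ) :
    bgf N r (t + 1) α ρ w =
      ((-1) ^ (t + 1) * ∏ j : Fin (t + 1), ∏ _k ∈ Ioi j, (-1 : ℂ)) *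
      det (of fun j l : Fin (t + 1) =>
        if j = 0 then ∑ k ∈ range r, (w : ℂ) ^ k *
          (contourCoeff α ρ (k + 1 - (l : ℕ)) (N - 1) (t + 1) -
            contourCoeff α ρ (k - (l : ℕ)) (N - 1) (t + 1))
        else contourCoeff α ρ (r - (l : ℕ)) (N - 1 - (j : ℕ)) (t + 1 - (j : ℕ))) := by
  set Y : Matrix (Fin (t + 1)) (Fin (t + 1)) ℂ := of fun j l =>
    contourCoeff α ρ (r - (l : ℕ)) (N - 1 - (j : ℕ)) (t + 1 - (j : ℕ)) with hY
  let L : (Fin (t + 1) → ℂ) →ₗ[ℂ] ℂ :=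
    (detRowAlternating (R := ℂ) (n := Fin (t + 1))).toMultilinearMap.toLinearMap Y 0
  have hL : ∀ x, L x = det (of fun j l => if j = 0 then x l else Y j l) := by
    intro x
    change det (Function.update Y 0 x) = _
    congr 1
    ext j l
    by_cases h : j = 0
    · subst h
      simpa using congrFun (Function.update_self (0 : Fin (t + 1)) x Y) l
    · simpa [h] using congrFun (Function.update_of_ne h x Y) l
  have hg : ∀ p : ℕ, gefp N (t + 1) α (fun j => if (j : ℕ) = 0 then p else r) ρ =
      ((-1) ^ (t + 1) * ∏ j : Fin (t + 1), ∏ _k ∈ Ioi j, (-1 : ℂ)) *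
        L (fun l => contourCoeff α ρ (p - (l : ℕ)) (N - 1) (t + 1)) := by
    intro p
    rw [gefp_eq_det hρ, hL]
    congr 2
    ext j l
    by_cases h : j = 0
    · subst h; simp
    · have : (j : ℕ) ≠ 0 := fun h' => h (Fin.ext h')
      simp [h, hY]
  have hR : bgf N r (t + 1) α ρ w = ∑ k ∈ range r,
      (gefp N (t + 1) α (fun j => if (j : ℕ) = 0 then k + 1 else r) ρ -
        gefp N (t + 1) α (fun j => if (j : ℕ) = 0 then k else r) ρ) * (w : ℂ) ^ k := by
    rw [bgf, ← Finset.Ico_add_one_right_eq_Icc, sum_Ico_eq_sum_range]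
    refine sum_congr (by simp) fun k _ => ?_
    simp [add_comm 1 k]
  have hx : det (of fun j l : Fin (t + 1) =>
        if j = 0 then ∑ k ∈ range r, (w : ℂ) ^ k *
          (contourCoeff α ρ (k + 1 - (l : ℕ)) (N - 1) (t + 1) -
            contourCoeff α ρ (k - (l : ℕ)) (N - 1) (t + 1))
        else contourCoeff α ρ (r - (l : ℕ)) (N - 1 - (j : ℕ)) (t + 1 - (j : ℕ))) =
      L (∑ k ∈ range r, (w : ℂ) ^ k •
          ((fun l : Fin (t + 1) => contourCoeff α ρ (k + 1 - (l : ℕ)) (N - 1) (t + 1)) -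
            fun l : Fin (t + 1) => contourCoeff α ρ (k - (l : ℕ)) (N - 1) (t + 1))) := by
    rw [hL]
    congr 1
    ext j l
    by_cases h : j = 0
    · subst h; simp
    · simp [h, hY]
  rw [hx, hR, map_sum, mul_sum]
  refine sum_congr rfl fun k _ => ?_
  rw [map_smul, map_sub, hg, hg, smul_eq_mul]
  ring

/-- Andréief's identity for a finite weighted sum. -/
theorem factorial_mul_det_sum_mul_mul {n ι : Type*} [Fintype n] [DecidableEq n] [Fintype ι]
    (μ : ι → ℂ) (φ ψ : n → ι → ℂ) :
    ((Fintype.card n).factorial : ℂ) * det (of fun j l => ∑ m, μ m * φ j m * ψ l m) =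
      ∑ m : n → ι, (∏ j, μ (m j)) * det (of fun j k => φ j (m k)) *
        det (of fun k l => ψ l (m k)) := by
  classical
  have h1 : det (of fun j l => ∑ m, μ m * φ j m * ψ l m) =
      ∑ m : n → ι, (∏ j, μ (m j) * φ j (m j)) * det (of fun k l => ψ l (m k)) := by
    have := (detRowAlternating (R := ℂ) (n := n)).toMultilinearMap.map_sum
      (fun j m l => μ m * φ j m * ψ l m)
    have h0 : (of fun j l => ∑ m, μ m * φ j m * ψ l m) =
        fun j => ∑ m, fun l => μ m * φ j m * ψ l m := by
      ext j l; simp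
    rw [h0]
    refine this.trans (sum_congr rfl fun m _ => ?_)
    exact det_mul_column (fun j => μ (m j) * φ j (m j)) (of fun k l => ψ l (m k))
  have h2 : ∀ σ : Equiv.Perm n, det (of fun j l => ∑ m, μ m * φ j m * ψ l m) =
      ∑ m : n → ι, (∏ j, μ (m j)) * (((Equiv.Perm.sign σ : ℤ) : ℂ) * ∏ j, φ j (m (σ j))) *
        det (of fun k l => ψ l (m k)) := by
    intro σ
    rw [h1, ← (Equiv.arrowCongr σ.symm (Equiv.refl ι)).sum_comp]
    refine sum_congr rfl fun m _ => ?_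
    have hd : det (of fun k l => ψ l (m (σ k))) =
        ((Equiv.Perm.sign σ : ℤ) : ℂ) * det (of fun k l => ψ l (m k)) :=
      det_permute σ (of fun k l => ψ l (m k))
    have hp : ∏ j, μ (m (σ j)) = ∏ j, μ (m j) := Equiv.prod_comp σ fun j => μ (m j)
    simp only [Equiv.arrowCongr_apply, Equiv.coe_refl, Function.comp_apply, id_eq,
      Equiv.symm_symm, prod_mul_distrib, hd, hp]
    ring
  have h3 : ((Fintype.card n).factorial : ℂ) *
      det (of fun j l => ∑ m, μ m * φ j m * ψ l m) =
      ∑ _σ : Equiv.Perm n, det (of fun j l => ∑ m, μ m * φ j m * ψ l m) := by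
    simp [Fintype.card_perm]
  rw [h3, sum_congr rfl fun σ _ => h2 σ, sum_comm]
  refine sum_congr rfl fun m _ => ?_
  rw [← sum_mul, ← mul_sum]
  congr 2
  rw [← det_transpose, det_apply']
  simp

end determinants

section generatingSeries

variable {α ρ : ℝ}

open Finset PowerSeries

/-- The geometric power series with ratio `c`. -/
noncomputable def geomSeries (c : ℂ) : PowerSeries ℂ := PowerSeries.mk fun n => c ^ n

theorem geomSeries_mul (c : ℂ) : geomSeries c * (1 - C c * X) = 1 := by
  ext n
  rw [mul_sub, mul_one, ← mul_assoc, map_sub]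
  cases n with
  | zero => simp [geomSeries]
  | succ n =>
    rw [coeff_succ_mul_X, mul_comm, coeff_C_mul]
    simp [geomSeries, pow_succ', coeff_one]

theorem coeff_succ_geomSeries_mul (c : ℂ) (f : PowerSeries ℂ) (n : ℕ) :
    coeff (n + 1) (geomSeries c * f) = c * coeff n (geomSeries c * f) + coeff (n + 1) f := by
  have h : geomSeries c * f = f + C c * ((geomSeries c * f) * X) := by
    linear_combination f * geomSeries_mul c
  conv_lhs => rw [h]
  rw [map_add, coeff_C_mul, coeff_succ_mul_X, add_comm]

theorem coeff_zero_geomSeries_mul (c : ℂ) (f : PowerSeries ℂ) :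
    coeff 0 (geomSeries c * f) = coeff 0 f := by
  simp [geomSeries]

/-- The generating series of the contour coefficients along a diagonal. -/
noncomputable def contourSeries (α ρ : ℝ) (b a : ℕ) : PowerSeries ℂ :=
  PowerSeries.mk fun n => contourCoeff α ρ (n + 1) (b + a + n) a

/-- The power series `((1 - α) / (1 - α X)) ^ b / (1 - α X)`. -/
noncomputable def binomialWeightSeries (α : ℝ) (b : ℕ) : PowerSeries ℂ :=
  PowerSeries.mk fun n => (b + n).choose n * (α : ℂ) ^ n * (1 - α) ^ b

theorem contourSeries_succ (hρ : ρ ∈ Set.Ioo (0 : ℝ) 1) (b a : ℕ) :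
    contourSeries α ρ b (a + 1) = C (α - 1 : ℂ) * (geomSeries 1 * contourSeries α ρ b a) := by
  have h : contourSeries α ρ b (a + 1) * (1 - C 1 * X) =
      C (α - 1 : ℂ) * contourSeries α ρ b a := by
    ext n
    rw [map_one, one_mul, mul_sub, mul_one, map_sub, coeff_C_mul]
    cases n with
    | zero =>
      simp only [coeff_zero_mul_X, contourSeries, coeff_mk]
      have h1 := contourCoeff_sub (α := α) hρ 0 (b + a) a
      have h2 := contourCoeff_succ_succ (α := α) hρ 0 (b + a) (a + 1)
      rw [contourCoeff_zero hρ] at h1 h2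
      simp only [zero_add, add_zero, ← add_assoc] at h1 h2 ⊢
      linear_combination h2 + (α - 1 : ℂ) * h1
    | succ n =>
      simp only [coeff_succ_mul_X, contourSeries, coeff_mk]
      have h1 := contourCoeff_sub (α := α) hρ (n + 1) (b + a + n + 1) a
      have h2 := contourCoeff_succ_succ (α := α) hρ (n + 1) (b + a + n + 1) (a + 1)
      rw [show b + (a + 1) + (n + 1) = b + a + n + 1 + 1 by ring,
        show b + (a + 1) + n = b + a + n + 1 by ring,
        show b + a + (n + 1) = b + a + n + 1 by ring]
      linear_combination h2 + (α - 1 : ℂ) * h1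
  linear_combination geomSeries 1 * h - contourSeries α ρ b (a + 1) * geomSeries_mul 1

theorem contourSeries_eq (hρ : ρ ∈ Set.Ioo (0 : ℝ) 1) (b a : ℕ) :
    contourSeries α ρ b a =
      C ((α - 1 : ℂ) ^ a) * (binomialWeightSeries α b * geomSeries 1 ^ a) := by
  induction a with
  | zero =>
    ext n
    simp [contourSeries, binomialWeightSeries, contourCoeff_succ_zero hρ]
  | succ a ih =>
    rw [contourSeries_succ hρ, ih, pow_succ, pow_succ, map_mul]
    ring

theorem sum_pow_mul_contourCoeff (hρ : ρ ∈ Set.Ioo (0 : ℝ) 1) {w u : ℂ}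
    (hu : u * w = α * w + 1 - α) (b a n : ℕ) :
    ∑ i ∈ range (n + 1), w ^ i * contourCoeff α ρ (i + 1) (b + a + 1 + n) a =
      (1 - α) * w ^ n * coeff n (geomSeries u * contourSeries α ρ b a) := by
  induction n with
  | zero =>
    rw [coeff_zero_geomSeries_mul]
    simp [contourSeries, contourCoeff_succ_succ hρ, contourCoeff_zero hρ]
  | succ n ih =>
    have h1 : ∑ i ∈ range (n + 1 + 1), w ^ i * contourCoeff α ρ i (b + a + 1 + n) a =
        w * ∑ i ∈ range (n + 1), w ^ i * contourCoeff α ρ (i + 1) (b + a + 1 + n) a := by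
      rw [sum_range_succ', contourCoeff_zero hρ, mul_zero, add_zero, mul_sum]
      exact sum_congr rfl fun i _ => by ring
    have h2 : ∑ i ∈ range (n + 1 + 1), w ^ i * contourCoeff α ρ (i + 1) (b + a + 1 + (n + 1)) a =
        (1 - α) * ∑ i ∈ range (n + 1 + 1), w ^ i * contourCoeff α ρ (i + 1) (b + a + 1 + n) a +
          α * ∑ i ∈ range (n + 1 + 1), w ^ i * contourCoeff α ρ i (b + a + 1 + n) a := by
      rw [mul_sum, mul_sum, ← sum_add_distrib]
      refine sum_congr rfl fun i _ => ?_
      rw [← add_assoc _ n 1, contourCoeff_succ_succ hρ]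
      ring
    rw [h2, h1, sum_range_succ, ih, coeff_succ_geomSeries_mul]
    have h3 : coeff (n + 1) (contourSeries α ρ b a) =
        contourCoeff α ρ (n + 1 + 1) (b + a + 1 + n) a := by
      rw [contourSeries, coeff_mk, add_right_comm (b + a) 1 n, add_assoc (b + a) n 1]
    rw [h3]
    linear_combination (-(1 - α) * w ^ n * coeff n (geomSeries u * contourSeries α ρ b a)) * hu

/-- The normalisation relating binomial coefficients to falling factorials. -/
noncomputable def columnConst (α : ℝ) (q l : ℕ) : ℂ :=
  (1 - α) ^ (q + l) * ((α : ℂ) ^ l)⁻¹ * q.factorial / (q + l).factorial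

theorem columnConst_ne_zero (hα : α ∈ Set.Ioo (0 : ℝ) 1) (q l : ℕ) : columnConst α q l ≠ 0 := by
  have h0 : (α : ℂ) ≠ 0 := by exact_mod_cast hα.1.ne'
  have h1 : (1 - α : ℂ) ≠ 0 := sub_ne_zero.2 (by exact_mod_cast hα.2.ne')
  have h2 := Nat.factorial_ne_zero q
  have h3 := Nat.factorial_ne_zero (q + l)
  simp only [columnConst]
  positivity

theorem coeff_binomialWeightSeries_mul (hα : α ∈ Set.Ioo (0 : ℝ) 1) (q l n : ℕ)
    (f : PowerSeries ℂ) :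
    coeff n (binomialWeightSeries α (q + l) * f) = columnConst α q l *
      ∑ m ∈ range (l + n + 1), (α : ℂ) ^ m * (q + m).choose q * coeff (l + n - m) f *
        (m.descFactorial l : ℂ) := by
  have h0 : (α : ℂ) ≠ 0 := by exact_mod_cast hα.1.ne'
  rw [add_assoc, sum_range_add, sum_eq_zero (s := range l), zero_add, coeff_mul,
    Nat.sum_antidiagonal_eq_sum_range_succ
      (fun i j => coeff i (binomialWeightSeries α (q + l)) * coeff j f), mul_sum]
  · refine sum_congr rfl fun i _ => ?_
    rw [Nat.add_sub_add_left, binomialWeightSeries, coeff_mk]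
    have e1 := Nat.add_choose_mul_factorial_mul_factorial (q + l) i
    have e2 := Nat.add_choose_mul_factorial_mul_factorial q (l + i)
    have e3 := Nat.factorial_mul_descFactorial (Nat.le_add_right l i)
    rw [Nat.add_sub_cancel_left] at e3
    have key : (q + l + i).choose i * (q + l).factorial =
        q.factorial * (q + (l + i)).choose q * (l + i).descFactorial l := by
      rw [Nat.choose_symm_add (a := q)]
      refine Nat.eq_of_mul_eq_mul_right i.factorial_pos ?_
      rw [e1, mul_assoc, mul_comm _ i.factorial, e3, add_assoc, ← e2]
      ring
    have key' : ((q + l + i).choose i : ℂ) * (q + l).factorial =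
        q.factorial * (q + (l + i)).choose q * (l + i).descFactorial l := by exact_mod_cast key
    have h3 : ((q + l).factorial : ℂ) ≠ 0 := by exact_mod_cast (q + l).factorial_ne_zero
    rw [eq_div_of_mul_eq h3 key', columnConst, pow_add (α : ℂ) l i]
    field_simp
  · intro m hm
    simp [Nat.descFactorial_of_lt (mem_range.1 hm)]

end generatingSeries

section polynomialRows

open Finset Polynomial

/-- The monic polynomial of degree `a` with roots `R + 1, …, R + a`. -/
noncomputable def shiftedPochhammer (R a : ℕ) : ℂ[X] :=
  ∏ i ∈ range a, (X - C ((R : ℂ) + 1 + i))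

theorem monic_shiftedPochhammer (R a : ℕ) : (shiftedPochhammer R a).Monic :=
  monic_prod_of_monic _ _ fun _ _ => monic_X_sub_C _

theorem natDegree_shiftedPochhammer (R a : ℕ) : (shiftedPochhammer R a).natDegree = a := by
  rw [shiftedPochhammer, natDegree_prod_of_monic _ _ fun _ _ => monic_X_sub_C _]
  simp only [natDegree_X_sub_C, sum_const, card_range, smul_eq_mul, mul_one]

theorem coeff_geomSeries_one_pow_succ (a : ℕ) {R m : ℕ} (hm : m ≤ R) :
    PowerSeries.coeff (R - m) (geomSeries 1 ^ (a + 1)) =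
      (-1) ^ a / a.factorial * (shiftedPochhammer R a).eval (m : ℂ) := by
  obtain ⟨k, rfl⟩ := Nat.exists_eq_add_of_le hm
  have h1 : geomSeries 1 = PowerSeries.mk 1 := by ext; simp [geomSeries]
  rw [h1, PowerSeries.mk_one_pow_eq_mk_choose_add, PowerSeries.coeff_mk, Nat.add_sub_cancel_left]
  have h2 : (shiftedPochhammer (m + k) a).eval (m : ℂ) =
      (-1) ^ a * ((k + 1).ascFactorial a : ℂ) := by
    rw [shiftedPochhammer, eval_prod, Nat.ascFactorial_eq_prod_range]
    push_cast
    rw [← card_range a, ← prod_const, card_range, ← prod_mul_distrib]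
    refine prod_congr rfl fun i _ => ?_
    simp
    ring
  have h3 : ((k + 1).ascFactorial a : ℂ) = a.factorial * (a + k).choose a := by
    rw [add_comm a k]
    exact_mod_cast Nat.ascFactorial_eq_factorial_mul_choose k a
  have h4 : (a.factorial : ℂ) ≠ 0 := by exact_mod_cast a.factorial_ne_zero
  have h5 : ((-1 : ℂ) ^ a) * (-1) ^ a = 1 := by rw [← mul_pow]; simp
  rw [h2, h3]
  field_simp
  linear_combination (-((a + k).choose a : ℂ)) * h5

theorem exists_coeff_geomSeries_mul_eq {u : ℂ} (hu : u ≠ 1) (R a : ℕ) :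
    ∃ p : ℂ[X], p.degree < a ∧ ∀ m ≤ R,
      PowerSeries.coeff (R - m) (geomSeries u * geomSeries 1 ^ a) =
        u ^ (R - m + a) / (u - 1) ^ a + p.eval (m : ℂ) := by
  have hu' : u - 1 ≠ 0 := sub_ne_zero.2 hu
  induction a with
  | zero => exact ⟨0, by simp, fun m _ => by simp [geomSeries]⟩
  | succ a ih =>
    obtain ⟨p, hp, h⟩ := ih
    refine ⟨C (u / (u - 1)) * p +
      C (-((-1) ^ a / a.factorial) / (u - 1)) * shiftedPochhammer R a, ?_, fun m hm => ?_⟩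
    · have ha : (a : WithBot ℕ) < (a + 1 : ℕ) := by exact_mod_cast a.lt_succ_self
      refine (degree_add_le _ _).trans_lt (max_lt ?_ ?_)
      · rw [← smul_eq_C_mul]
        exact (degree_smul_le _ _).trans_lt (hp.trans ha)
      · rw [← smul_eq_C_mul]
        refine (degree_smul_le _ _).trans_lt (lt_of_le_of_lt ?_ ha)
        exact degree_le_natDegree.trans (by rw [natDegree_shiftedPochhammer])
    · have hs : PowerSeries.C (u - 1) * (geomSeries u * geomSeries 1 ^ (a + 1)) =
          PowerSeries.C u * (geomSeries u * geomSeries 1 ^ a) - geomSeries 1 ^ (a + 1) := by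
        have h1 := geomSeries_mul u
        have h2 := geomSeries_mul 1
        simp only [map_sub, map_one] at h2 ⊢
        linear_combination (-geomSeries 1 ^ (a + 1)) * h1 +
          PowerSeries.C u * geomSeries u * geomSeries 1 ^ a * h2
      have hc := congrArg (PowerSeries.coeff (R - m)) hs
      rw [PowerSeries.coeff_C_mul, map_sub, PowerSeries.coeff_C_mul, h m hm,
        coeff_geomSeries_one_pow_succ a hm] at hc
      rw [← mul_right_inj' hu', hc]
      simp only [eval_add, eval_mul, eval_C]
      field_simp
      ring

/-- The divided difference of `f` at the nodes `v`. -/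
noncomputable def dividedDifference {n : ℕ} (v f : Fin n → ℂ) : ℂ :=
  ∑ i, f i / ∏ k ∈ univ.erase i, (v i - v k)

theorem dividedDifference_eval {t : ℕ} {v : Fin (t + 1) → ℂ} (hv : Function.Injective v)
    {p : ℂ[X]} (hp : p.degree < (t + 1 : ℕ)) :
    dividedDifference v (fun i => p.eval (v i)) = p.coeff t := by
  have := Lagrange.coeff_eq_sum (s := univ) hv.injOn (P := p) (by simpa using hp)
  simpa [dividedDifference] using this.symm

theorem dividedDifference_add {n : ℕ} (v f g : Fin n → ℂ) :
    dividedDifference v (fun i => f i + g i) =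
      dividedDifference v f + dividedDifference v g := by
  simp [dividedDifference, add_div, sum_add_distrib]

theorem dividedDifference_const_mul {n : ℕ} (v f : Fin n → ℂ) (c : ℂ) :
    dividedDifference v (fun i => c * f i) = c * dividedDifference v f := by
  simp [dividedDifference, mul_sum, mul_div_assoc]

theorem circleIntegral_div_prod_sub {n : ℕ} {v : Fin n → ℂ} (hn : 0 < n)
    (hv : Function.Injective v) {ρ : ℝ} (hvρ : ∀ i, v i ∈ Metric.ball (0 : ℂ) ρ)
    {f : ℂ → ℂ} (hf : Differentiable ℂ f) :
    (2 * Real.pi * Complex.I)⁻¹ * (∮ z in C(0, ρ), f z / ∏ i, (z - v i)) =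
      dividedDifference v (fun i => f (v i)) := by
  have hρ : 0 ≤ ρ := (Metric.pos_of_mem_ball (hvρ ⟨0, hn⟩)).le
  have hne : ∀ z ∈ Metric.sphere (0 : ℂ) ρ, ∀ i, z ≠ v i := by
    rintro z hz i rfl
    have := hvρ i
    simp at hz this
    exact this.ne hz
  have h1 : (∮ z in C(0, ρ), f z / ∏ i, (z - v i)) =
      ∮ z in C(0, ρ), ∑ i, (∏ k ∈ univ.erase i, (v i - v k))⁻¹ * ((z - v i)⁻¹ * f z) := by
    refine circleIntegral.integral_congr hρ fun z hz => ?_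
    have hL := Lagrange.eval_interpolate_not_at_node (s := univ) (v := v) (x := z) 1
      fun i _ => hne z hz i
    have h1 : Lagrange.interpolate univ v (1 : Fin n → ℂ) = 1 :=
      Lagrange.interpolate_one hv.injOn ⟨⟨0, hn⟩, mem_univ _⟩
    rw [h1, eval_one, Lagrange.eval_nodal] at hL
    have hP : ∏ i, (z - v i) ≠ 0 := prod_ne_zero_iff.2 fun i _ => sub_ne_zero.2 (hne z hz i)
    simp only [div_eq_iff hP]
    rw [sum_mul]
    simp only [Lagrange.nodalWeight, Pi.one_apply, mul_one, prod_inv_distrib] at hL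
    calc f z = f z * 1 := (mul_one _).symm
      _ = _ := by
        rw [hL, mul_sum, mul_sum]
        exact sum_congr rfl fun i _ => by ring
  have hint : ∀ i ∈ univ, CircleIntegrable
      (fun z => (∏ k ∈ univ.erase i, (v i - v k))⁻¹ * ((z - v i)⁻¹ * f z)) 0 ρ := fun i _ => by
    refine ContinuousOn.circleIntegrable hρ (continuousOn_const.mul (ContinuousOn.mul
      (ContinuousOn.inv₀ (by fun_prop) fun z hz => sub_ne_zero.2 (hne z hz i))
      hf.continuous.continuousOn))
  rw [h1, circleIntegral.integral_fun_sum hint, mul_sum]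
  refine sum_congr rfl fun i _ => ?_
  have hC := DifferentiableOn.circleIntegral_sub_inv_smul (hf.differentiableOn) (hvρ i)
  simp only [smul_eq_mul] at hC
  have h2 := Complex.two_pi_I_ne_zero
  rw [circleIntegral.integral_const_mul, hC]
  field_simp

open Matrix in
theorem det_row_eq_dividedDifference {t : ℕ} {v : Fin (t + 1) → ℂ} (hv : Function.Injective v)
    (f : Fin (t + 1) → ℂ) (c : ℕ → ℂ) {p : ℕ → ℂ[X]} (hp : ∀ a, (p a).Monic)
    (hd : ∀ a, (p a).natDegree = a) :
    det (of fun j k : Fin (t + 1) => if j = 0 then f k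
      else c (t - (j : ℕ)) * (p (t - (j : ℕ))).eval (v k)) =
    (((Equiv.Perm.sign (Fin.revPerm (n := t + 1)) : ℤ) : ℂ) * ∏ j : Fin t, c j) *
      (det (vandermonde v) * dividedDifference v f) := by
  set L := Lagrange.interpolate univ v f
  have hLd : L.degree < (t + 1 : ℕ) := by
    have := Lagrange.degree_interpolate_lt (s := univ) f hv.injOn
    rwa [card_univ, Fintype.card_fin] at this
  have hLv : ∀ i, L.eval (v i) = f i := fun i =>
    Lagrange.eval_interpolate_at_node f hv.injOn (mem_univ i)
  let P : Fin (t + 1) → ℂ[X] := fun j => if j = Fin.last t then L else C (c j) * p j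
  have hP : ∀ i, (P i).natDegree ≤ i := by
    intro i
    by_cases h : i = Fin.last t
    · subst h
      simp only [P, if_true, Fin.val_last]
      exact natDegree_le_iff_coeff_eq_zero.2 fun N hN =>
        coeff_eq_zero_of_degree_lt (hLd.trans_le (by exact_mod_cast hN))
    · simp only [P, if_neg h]
      exact (natDegree_C_mul_le _ _).trans (hd i).le
  have h1 : (of fun j k : Fin (t + 1) => if j = 0 then f k
      else c (t - (j : ℕ)) * (p (t - (j : ℕ))).eval (v k)) =
      (of fun i j => (P j).eval (v i))ᵀ.submatrix (Fin.revPerm (n := t + 1)) id := by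
    ext j k
    by_cases h : j = 0
    · subst h
      simp [P, hLv]
    · have h' : ¬ Fin.rev j = Fin.last t := by
        rwa [← Fin.rev_zero, Fin.rev_inj]
      simp [P, h, h', Fin.val_rev]
  have h2 : det (of fun i j : Fin (t + 1) => (P j).coeff i) =
      (∏ j : Fin t, c j) * dividedDifference v f := by
    rw [det_of_isUpperTriangular, Fin.prod_univ_castSucc]
    · congr 1
      · refine prod_congr rfl fun j _ => ?_
        have hm := (hp j).coeff_natDegree
        rw [hd] at hm
        simp [P, Fin.castSucc_ne_last, hm]
      · rw [← funext hLv, dividedDifference_eval hv hLd]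
        simp [P]
    · intro i j hij
      exact coeff_eq_zero_of_natDegree_lt ((hP j).trans_lt hij)
  rw [h1, det_permute, det_transpose,
    eval_matrixOfPolynomials_eq_vandermonde_mul_matrixOfPolynomials v P hP, det_mul, h2]
  ring

end polynomialRows

section boundaryGeneratingFunction

variable {α ρ : ℝ}

open Finset PowerSeries Matrix

theorem contourCoeff_eq_sum (hα : α ∈ Set.Ioo (0 : ℝ) 1) (hρ : ρ ∈ Set.Ioo (0 : ℝ) 1)
    (q R a l : ℕ) :
    contourCoeff α ρ (R + 1 - l) (q + R + a) a =
      (α - 1) ^ a * columnConst α q l * ∑ m ∈ range (R + 1),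
        (α : ℂ) ^ m * (q + m).choose q * coeff (R - m) (geomSeries 1 ^ a) *
          (m.descFactorial l : ℂ) := by
  rcases Nat.lt_or_ge R l with h | h
  · rw [Nat.sub_eq_zero_of_le h, contourCoeff_zero hρ, sum_eq_zero, mul_zero]
    intro m hm
    have hm' := mem_range.1 hm
    rw [Nat.descFactorial_of_lt (by omega)]
    simp
  · obtain ⟨n, rfl⟩ := Nat.exists_eq_add_of_le h
    have h1 := congrArg (coeff n) (contourSeries_eq (α := α) hρ (q + l) a)
    rw [contourSeries, coeff_mk, coeff_C_mul, coeff_binomialWeightSeries_mul hα] at h1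
    rw [show l + n + 1 - l = n + 1 by omega, show q + (l + n) + a = q + l + a + n by ring, h1,
      mul_assoc]

theorem sum_pow_mul_contourCoeff_sub (hα : α ∈ Set.Ioo (0 : ℝ) 1)
    (hρ : ρ ∈ Set.Ioo (0 : ℝ) 1) {w u : ℂ} (hu : u * w = α * w + 1 - α) (q R a l : ℕ) :
    ∑ k ∈ range (R + 1), w ^ k * (contourCoeff α ρ (k + 1 - l) (q + R + a + 1) (a + 1) -
        contourCoeff α ρ (k - l) (q + R + a + 1) (a + 1)) =
      (α - 1) ^ (a + 1) * w ^ R * columnConst α q l * ∑ m ∈ range (R + 1),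
        (α : ℂ) ^ m * (q + m).choose q * coeff (R - m) (geomSeries u * geomSeries 1 ^ a) *
          (m.descFactorial l : ℂ) := by
  rcases Nat.lt_or_ge R l with h | h
  · rw [sum_eq_zero, sum_eq_zero, mul_zero]
    · intro m hm
      have hm' := mem_range.1 hm
      rw [Nat.descFactorial_of_lt (by omega)]
      simp
    · intro k hk
      have hk' := mem_range.1 hk
      rw [Nat.sub_eq_zero_of_le (show k + 1 ≤ l by omega),
        Nat.sub_eq_zero_of_le (show k ≤ l by omega), sub_self, mul_zero]
  · obtain ⟨n, rfl⟩ := Nat.exists_eq_add_of_le h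
    have h1 := sum_pow_mul_contourCoeff (α := α) hρ hu (q + l) a n
    have h2 : geomSeries u * contourSeries α ρ (q + l) a = C ((α - 1 : ℂ) ^ a) *
        (binomialWeightSeries α (q + l) * (geomSeries u * geomSeries 1 ^ a)) := by
      rw [contourSeries_eq hρ]
      ring
    rw [h2, coeff_C_mul, coeff_binomialWeightSeries_mul hα] at h1
    rw [add_assoc l n 1, sum_range_add, sum_eq_zero (s := range l), zero_add]
    · have h3 : ∀ i ∈ range (n + 1), w ^ (l + i) *
          (contourCoeff α ρ (l + i + 1 - l) (q + (l + n) + a + 1) (a + 1) -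
            contourCoeff α ρ (l + i - l) (q + (l + n) + a + 1) (a + 1)) =
          -w ^ l * (w ^ i * contourCoeff α ρ (i + 1) (q + l + a + 1 + n) a) := by
        intro i _
        rw [show l + i + 1 - l = i + 1 by omega, show l + i - l = i by omega,
          show q + (l + n) + a + 1 = q + l + a + 1 + n by ring,
          ← contourCoeff_sub hρ i (q + l + a + 1 + n) a]
        ring
      rw [sum_congr rfl h3, ← mul_sum, h1, ← add_assoc l n 1]
      generalize ∑ m ∈ range (l + n + 1), (α : ℂ) ^ m * (q + m).choose q *
        coeff (l + n - m) (geomSeries u * geomSeries 1 ^ a) * (m.descFactorial l : ℂ) = S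
      ring
    · intro k hk
      have hk' := mem_range.1 hk
      rw [Nat.sub_eq_zero_of_le (show k + 1 ≤ l by omega),
        Nat.sub_eq_zero_of_le (show k ≤ l by omega), sub_self, mul_zero]

/-- The values at the lattice site `m` of the rows of the determinant representing the boundary
generating function. -/
noncomputable def bgfRow (R t : ℕ) (u : ℂ) (j m : ℕ) : ℂ :=
  if j = 0 then coeff (R - m) (geomSeries u * geomSeries 1 ^ t)
  else coeff (R - m) (geomSeries 1 ^ (t + 1 - j))

/-- The single-particle weight of the log-gas. -/
noncomputable def logGasWeight (α : ℝ) (q m : ℕ) : ℂ := (α : ℂ) ^ m * (q + m).choose q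

theorem bgf_eq_mul_det (hα : α ∈ Set.Ioo (0 : ℝ) 1) (hρ : ρ ∈ Set.Ioo (0 : ℝ) 1)
    (q R t : ℕ) : ∃ K : ℂ, K ≠ 0 ∧ ∀ (w : ℝ) (u : ℂ), u * w = α * w + 1 - α →
      bgf (q + (R + 1) + (t + 1)) (R + 1) (t + 1) α ρ w = K * (w : ℂ) ^ R *
        det (of fun j l : Fin (t + 1) => ∑ m : Fin (R + 1),
          logGasWeight α q m * bgfRow R t u j m * ((m : ℕ).descFactorial l : ℂ)) := by
  have hα' : (α - 1 : ℂ) ≠ 0 := sub_ne_zero.2 (by exact_mod_cast hα.2.ne)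
  refine ⟨((-1) ^ (t + 1) * ∏ j : Fin (t + 1), ∏ _k ∈ Ioi j, (-1 : ℂ)) *
    ((∏ j : Fin (t + 1), (α - 1 : ℂ) ^ (t + 1 - (j : ℕ))) *
      ∏ l : Fin (t + 1), columnConst α q l), ?_, fun w u hu => ?_⟩
  · refine mul_ne_zero (mul_ne_zero (pow_ne_zero _ (by norm_num))
      (prod_ne_zero_iff.2 fun _ _ => prod_ne_zero_iff.2 fun _ _ => by norm_num))
      (mul_ne_zero (prod_ne_zero_iff.2 fun _ _ => pow_ne_zero _ hα')
        (prod_ne_zero_iff.2 fun _ _ => columnConst_ne_zero hα _ _))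
  · set D : Matrix (Fin (t + 1)) (Fin (t + 1)) ℂ := of fun j l => ∑ m : Fin (R + 1),
      logGasWeight α q m * bgfRow R t u j m * ((m : ℕ).descFactorial l : ℂ)
    let c : Fin (t + 1) → ℂ := fun j =>
      (α - 1 : ℂ) ^ (t + 1 - (j : ℕ)) * if j = 0 then (w : ℂ) ^ R else 1
    have hc : ∏ j, c j =
        (∏ j : Fin (t + 1), (α - 1 : ℂ) ^ (t + 1 - (j : ℕ))) * (w : ℂ) ^ R := by
      simp only [c, prod_mul_distrib]
      simp
    have hM : (of fun j l : Fin (t + 1) =>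
        if j = 0 then ∑ k ∈ range (R + 1), (w : ℂ) ^ k *
          (contourCoeff α ρ (k + 1 - (l : ℕ)) (q + (R + 1) + (t + 1) - 1) (t + 1) -
            contourCoeff α ρ (k - (l : ℕ)) (q + (R + 1) + (t + 1) - 1) (t + 1))
        else contourCoeff α ρ (R + 1 - (l : ℕ)) (q + (R + 1) + (t + 1) - 1 - (j : ℕ))
          (t + 1 - (j : ℕ))) =
        of fun j l : Fin (t + 1) =>
          c j * (of fun j l : Fin (t + 1) => columnConst α q (l : ℕ) * D j l) j l := by
      ext j l
      have hDj : D j l = ∑ m ∈ range (R + 1),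
          (α : ℂ) ^ m * (q + m).choose q * bgfRow R t u j m * (m.descFactorial l : ℂ) :=
        Fin.sum_univ_eq_sum_range (fun m =>
          (α : ℂ) ^ m * (q + m).choose q * bgfRow R t u j m * (m.descFactorial l : ℂ)) (R + 1)
      by_cases h : j = 0
      · subst h
        simp only [of_apply, if_true]
        rw [show q + (R + 1) + (t + 1) - 1 = q + R + t + 1 by omega,
          sum_pow_mul_contourCoeff_sub hα hρ hu, hDj]
        simp [c, bgfRow, mul_assoc]
      · have h' : (j : ℕ) ≠ 0 := fun h' => h (Fin.ext h')
        simp only [of_apply, if_neg h]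
        rw [show q + (R + 1) + (t + 1) - 1 - (j : ℕ) = q + R + (t + 1 - (j : ℕ)) by omega,
          contourCoeff_eq_sum hα hρ, hDj]
        simp [c, bgfRow, h, mul_assoc]
    rw [bgf_eq_det hρ, hM, det_mul_column, hc, det_mul_row]
    ring

theorem det_descFactorial {t : ℕ} (m : Fin (t + 1) → ℕ) :
    det (of fun k l : Fin (t + 1) => ((m k).descFactorial l : ℂ)) =
      det (vandermonde fun k => (m k : ℂ)) := by
  rw [det_eval_matrixOfPolynomials_eq_det_vandermonde _ (fun l => descPochhammer ℂ l)
    (fun l => descPochhammer_natDegree ℂ l) fun l => monic_descPochhammer ℂ l]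
  simp only [descPochhammer_eval_eq_descFactorial]

theorem cast_injective_of_injective {n R : ℕ} {m : Fin n → Fin R} (hm : Function.Injective m) :
    Function.Injective fun k => ((m k : ℕ) : ℂ) :=
  fun _ _ h => hm (Fin.ext (Nat.cast_injective (R := ℂ) h))

theorem det_bgfRow (R t : ℕ) : ∃ K : ℂ, K ≠ 0 ∧ ∀ (u : ℂ) (m : Fin (t + 1) → Fin (R + 1)),
    Function.Injective m → det (of fun j k : Fin (t + 1) => bgfRow R t u j (m k)) =
      K * (det (vandermonde fun k => ((m k : ℕ) : ℂ)) *
        dividedDifference (fun k => ((m k : ℕ) : ℂ)) fun k => bgfRow R t u 0 (m k)) := by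
  refine ⟨((Equiv.Perm.sign (Fin.revPerm (n := t + 1)) : ℤ) : ℂ) *
    ∏ j : Fin t, ((-1 : ℂ) ^ (j : ℕ) / (j : ℕ).factorial), ?_, fun u m hm => ?_⟩
  · refine mul_ne_zero (by exact_mod_cast Units.ne_zero _) (prod_ne_zero_iff.2 fun j _ =>
      div_ne_zero (pow_ne_zero _ (by norm_num)) (by exact_mod_cast (j : ℕ).factorial_ne_zero))
  · rw [← det_row_eq_dividedDifference (cast_injective_of_injective hm)
      (fun k => bgfRow R t u 0 (m k)) (fun a => (-1 : ℂ) ^ a / a.factorial)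
      (monic_shiftedPochhammer R) (natDegree_shiftedPochhammer R)]
    congr 1
    ext j k
    by_cases h : j = 0
    · subst h; simp
    · have h' : (j : ℕ) ≠ 0 := fun h' => h (Fin.ext h')
      simp only [of_apply, if_neg h, bgfRow, if_neg h']
      rw [show t + 1 - (j : ℕ) = t - (j : ℕ) + 1 by omega,
        coeff_geomSeries_one_pow_succ _ (Nat.lt_succ_iff.1 (m k).isLt)]

theorem bgf_eq_mul_sum (hα : α ∈ Set.Ioo (0 : ℝ) 1) (hρ : ρ ∈ Set.Ioo (0 : ℝ) 1)
    (q R t : ℕ) : ∃ K : ℂ, K ≠ 0 ∧ ∀ (w : ℝ) (u : ℂ), u * w = α * w + 1 - α →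
      bgf (q + (R + 1) + (t + 1)) (R + 1) (t + 1) α ρ w = K * (w : ℂ) ^ R *
        ∑ m : Fin (t + 1) → Fin (R + 1), (∏ j, logGasWeight α q (m j)) *
          det (vandermonde fun k => ((m k : ℕ) : ℂ)) ^ 2 *
          dividedDifference (fun k => ((m k : ℕ) : ℂ)) fun k => bgfRow R t u 0 (m k) := by
  obtain ⟨K₁, hK₁, h₁⟩ := bgf_eq_mul_det hα hρ q R t
  obtain ⟨K₂, hK₂, h₂⟩ := det_bgfRow R t
  have hf : ((t + 1).factorial : ℂ) ≠ 0 := by exact_mod_cast (t + 1).factorial_ne_zero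
  refine ⟨K₁ * K₂ / (t + 1).factorial, div_ne_zero (mul_ne_zero hK₁ hK₂) hf, fun w u hu => ?_⟩
  have h := factorial_mul_det_sum_mul_mul (n := Fin (t + 1)) (ι := Fin (R + 1))
    (fun m => logGasWeight α q m) (fun j m => bgfRow R t u j m)
    (fun l m => ((m : ℕ).descFactorial l : ℂ))
  rw [Fintype.card_fin] at h
  have hs : ∀ m : Fin (t + 1) → Fin (R + 1),
      (∏ j, logGasWeight α q (m j)) * det (of fun j k : Fin (t + 1) => bgfRow R t u j (m k)) *
        det (of fun k l : Fin (t + 1) => ((m k : ℕ).descFactorial l : ℂ)) =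
      K₂ * ((∏ j, logGasWeight α q (m j)) *
          det (vandermonde fun k => ((m k : ℕ) : ℂ)) ^ 2 *
          dividedDifference (fun k => ((m k : ℕ) : ℂ)) fun k => bgfRow R t u 0 (m k)) := by
    intro m
    rw [det_descFactorial fun k => (m k : ℕ)]
    by_cases hm : Function.Injective m
    · rw [h₂ u m hm]
      ring
    · have : det (vandermonde fun k => ((m k : ℕ) : ℂ)) = 0 := by
        by_contra hne
        exact hm fun a b hab => det_vandermonde_ne_zero_iff.1 hne (by simp [hab])
      simp [this]
  rw [sum_congr rfl fun m _ => hs m, ← mul_sum] at h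
  rw [h₁ w u hu, ← mul_right_inj' hf]
  field_simp
  linear_combination (w : ℂ) ^ R * h

theorem det_vandermonde_sq_eq_prod {n : ℕ} (v : Fin n → ℂ) :
    det (vandermonde v) ^ 2 = ∏ j, ∏ k ∈ Ioi j, (v k - v j) ^ 2 := by
  rw [det_vandermonde, ← prod_pow]
  exact prod_congr rfl fun j _ => (prod_pow _ _ _).symm

theorem dividedDifference_bgfRow_one {R t : ℕ} {m : Fin (t + 1) → Fin (R + 1)}
    (hm : Function.Injective m) :
    dividedDifference (fun k => ((m k : ℕ) : ℂ)) (fun k => bgfRow R t 1 0 (m k)) =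
      (-1) ^ t / t.factorial := by
  have h : (fun k => bgfRow R t 1 0 (m k)) = fun k =>
      (-1) ^ t / t.factorial * (shiftedPochhammer R t).eval ((m k : ℕ) : ℂ) := by
    ext k
    rw [← coeff_geomSeries_one_pow_succ _ (Nat.lt_succ_iff.1 (m k).isLt)]
    simp [bgfRow, pow_succ']
  have hd : (shiftedPochhammer R t).degree < (t + 1 : ℕ) := by
    refine Polynomial.degree_le_natDegree.trans_lt ?_
    rw [natDegree_shiftedPochhammer]
    exact_mod_cast t.lt_succ_self
  have hc := (monic_shiftedPochhammer R t).coeff_natDegree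
  rw [natDegree_shiftedPochhammer] at hc
  rw [h, dividedDifference_const_mul,
    dividedDifference_eval (cast_injective_of_injective hm) hd, hc, mul_one]

theorem dividedDifference_bgfRow {R t : ℕ} {m : Fin (t + 1) → Fin (R + 1)}
    (hm : Function.Injective m) {u : ℝ} (hu0 : 0 < u) (hu1 : u ≠ 1) {ρ : ℝ} (hρ : (R : ℝ) < ρ) :
    dividedDifference (fun k => ((m k : ℕ) : ℂ)) (fun k => bgfRow R t u 0 (m k)) =
      (-1) ^ t / t.factorial * ((2 * Real.pi * Complex.I)⁻¹ *
        ∮ z in C(0, ρ), sigmaFn (R + 1) (t + 1) u z / ∏ j, (z - ((m j : ℕ) : ℂ))) := by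
  have hu1' : (u : ℂ) ≠ 1 := by exact_mod_cast hu1
  obtain ⟨p, hp, h⟩ := exists_coeff_geomSeries_mul_eq hu1' R t
  have hv := cast_injective_of_injective hm
  have hf : (t.factorial : ℂ) ≠ 0 := by exact_mod_cast t.factorial_ne_zero
  have hsub : (1 - u : ℂ) ≠ 0 := sub_ne_zero.2 hu1'.symm
  have hrow : (fun k => bgfRow R t u 0 (m k)) = fun k =>
      (-1) ^ t / t.factorial * sigmaFn (R + 1) (t + 1) u ((m k : ℕ) : ℂ) +
        p.eval ((m k : ℕ) : ℂ) := by
    ext k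
    have hk := Nat.lt_succ_iff.1 (m k).isLt
    have hexp : Complex.exp ((((R + 1 : ℕ) : ℂ) + ((t + 1 : ℕ) : ℂ) - ((m k : ℕ) : ℂ) - 2) *
        (Real.log u : ℂ)) = (u : ℂ) ^ (R - (m k : ℕ) + t) := by
      have e : (((R + 1 : ℕ) : ℂ) + ((t + 1 : ℕ) : ℂ) - ((m k : ℕ) : ℂ) - 2) =
          ((R - (m k : ℕ) + t : ℕ) : ℂ) := by
        push_cast [Nat.cast_sub hk]
        ring
      rw [e, Complex.exp_nat_mul, ← Complex.ofReal_exp, Real.exp_log hu0]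
    have hpow : (u - 1 : ℂ) ^ t = (-1) ^ t * (1 - u) ^ t := by
      rw [← mul_pow]
      congr 1
      ring
    have h5 : ((-1 : ℂ) ^ t) * (-1) ^ t = 1 := by rw [← mul_pow]; simp
    simp only [bgfRow, if_true, h _ hk, sigmaFn, hexp, hpow, Nat.add_sub_cancel]
    congr 1
    field_simp
    linear_combination (-(u : ℂ) ^ (R - (m k : ℕ) + t)) * h5
  have hdiff : Differentiable ℂ (sigmaFn (R + 1) (t + 1) u) := by
    unfold sigmaFn
    fun_prop
  have hball : ∀ i, ((m i : ℕ) : ℂ) ∈ Metric.ball (0 : ℂ) ρ := by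
    intro i
    have : ((m i : ℕ) : ℝ) ≤ R := by exact_mod_cast Nat.lt_succ_iff.1 (m i).isLt
    simpa using this.trans_lt hρ
  rw [circleIntegral_div_prod_sub t.succ_pos hv hball hdiff, hrow, dividedDifference_add,
    dividedDifference_const_mul,
    dividedDifference_eval hv (hp.trans (by exact_mod_cast t.lt_succ_self)),
    Polynomial.coeff_eq_zero_of_degree_lt hp, add_zero]

end boundaryGeneratingFunction

/-- Proposition 1: log-gas representation of the boundary generating function:
`F_{N,r,s}(w)/F_{N,r,s}(1) = w^{r−1} · I_{N,r,s}(u)/I_{N,r,s}(1)` with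
`u = (αw+1−α)/w`. -/
theorem loggas_representation_of_boundary_generating_function
    (N r s : ℕ) (hr : 0 < r) (hs : 0 < s) (hN : r + s ≤ N)
    (α : ℝ) (hα : α ∈ Set.Ioo (0 : ℝ) 1)
    (w : ℝ) (hw : 0 < w) (hw1 : w ≠ 1)
    (u : ℝ) (hu : u = (α * w + 1 - α) / w)
    (ρG : ℝ) (hρG : ρG ∈ Set.Ioo (0 : ℝ) 1)
    (ρ : ℝ) (hρ : (r : ℝ) - 1 < ρ) :
    bgf N r s α ρG w / bgf N r s α ρG 1 =
      (w : ℂ) ^ (r - 1) * loggasI N r s α u ρ / (loggasI1 N r s α : ℂ) := by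
  obtain ⟨R, rfl⟩ := Nat.exists_eq_succ_of_ne_zero hr.ne'
  obtain ⟨t, rfl⟩ := Nat.exists_eq_succ_of_ne_zero hs.ne'
  obtain ⟨q, rfl⟩ : ∃ q, N = q + (R + 1) + (t + 1) := ⟨N - (R + 1) - (t + 1), by omega⟩
  simp only [Nat.succ_eq_add_one] at *
  have huw : u * w = α * w + 1 - α := by rw [hu, div_mul_cancel₀ _ hw.ne']
  have hu0 : 0 < u := hu ▸ div_pos (by nlinarith [hα.1, hα.2, mul_pos hα.1 hw]) hw
  have hu1 : u ≠ 1 := by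
    rintro rfl
    have : (1 - α) * (w - 1) = 0 := by linarith
    rcases mul_eq_zero.1 this with h | h
    · linarith [hα.2]
    · exact hw1 (by linarith)
  have hρ' : (R : ℝ) < ρ := by push_cast at hρ; linarith
  obtain ⟨K, hK, h⟩ := bgf_eq_mul_sum hα hρG q R t
  have hq : q + (R + 1) + (t + 1) - (R + 1) - (t + 1) = q := by omega
  have hc : ((-1 : ℂ) ^ t / t.factorial) ≠ 0 :=
    div_ne_zero (pow_ne_zero _ (by norm_num)) (by exact_mod_cast t.factorial_ne_zero)
  have hterm : ∀ (m : Fin (t + 1) → Fin (R + 1)) (x y : ℂ), (Function.Injective m → x = y) →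
      (∏ j, logGasWeight α q (m j)) *
          Matrix.det (Matrix.vandermonde fun k => ((m k : ℕ) : ℂ)) ^ 2 * x =
      (∏ j, logGasWeight α q (m j)) *
        (∏ j, ∏ k ∈ Finset.Ioi j, (((m k : ℕ) : ℂ) - ((m j : ℕ) : ℂ)) ^ 2) * y := by
    intro m x y hxy
    rw [← det_vandermonde_sq_eq_prod fun k => ((m k : ℕ) : ℂ)]
    by_cases hm : Function.Injective m
    · rw [hxy hm]
    · have : Matrix.det (Matrix.vandermonde fun k => ((m k : ℕ) : ℂ)) = 0 := by
        by_contra hne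
        exact hm fun a b hab => Matrix.det_vandermonde_ne_zero_iff.1 hne (by simp [hab])
      simp [this]
  have hF : bgf (q + (R + 1) + (t + 1)) (R + 1) (t + 1) α ρG w =
      K * ((-1) ^ t / t.factorial) * ((w : ℂ) ^ R *
        loggasI (q + (R + 1) + (t + 1)) (R + 1) (t + 1) α u ρ) := by
    rw [h w u (by exact_mod_cast huw), loggasI, hq,
      Finset.sum_congr rfl fun m _ => hterm m _ _ fun hm =>
        dividedDifference_bgfRow hm hu0 hu1 hρ']
    simp only [logGasWeight, Finset.mul_sum]
    exact Finset.sum_congr rfl fun m _ => by ring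
  have hF1 : bgf (q + (R + 1) + (t + 1)) (R + 1) (t + 1) α ρG 1 =
      K * ((-1) ^ t / t.factorial) *
        (loggasI1 (q + (R + 1) + (t + 1)) (R + 1) (t + 1) α : ℂ) := by
    rw [h 1 1 (by push_cast; ring), loggasI1, hq,
      Finset.sum_congr rfl fun m _ => hterm m _ _ fun hm => dividedDifference_bgfRow_one hm]
    push_cast
    simp only [logGasWeight, Finset.mul_sum]
    exact Finset.sum_congr rfl fun m _ => by ring
  rw [hF, hF1, mul_div_mul_left _ _ (mul_ne_zero hK hc), Nat.add_sub_cancel]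
end

section
/- Moment-determinant formula at w = 1. Let N, r, s be positive integers with r+s ≤ N, put q = N−r−s, and let α ∈ (0,1). Then F_{N,r,s}(1) = [(q!)^s / ∏_{j=0}^{s−1}((q+j)!·j!)] · (1−α)^{s(s+q)} · α^{−s(s−1)/2} · det[ Σ_{m=0}^{r−1} C(m+q,q)·m^{j+k−2}·α^m ]_{j,k=1,…,s}. -/
open Finset Metric

lemma circIntN_sum_prod {ι : Type*} (S : Finset ι) {ρ : ℝ} (n : ℕ) (c : ι → ℂ)
    (g : ι → Fin n → ℂ → ℂ) (hg : ∀ σ i, CircleIntegrable (g σ i) 0 ρ) :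
    circIntN n ρ (fun z => ∑ σ ∈ S, c σ * ∏ i, g σ i (z i)) =
      ∑ σ ∈ S, c σ * ∏ i, ∮ z in C(0, ρ), g σ i z := by
  induction n generalizing c with
  | zero => simp [circIntN]
  | succ n ih =>
    simp only [circIntN, Fin.prod_univ_succ, Fin.cons_zero, Fin.cons_succ, ← mul_assoc]
    have h (z : ℂ) := ih (fun σ => c σ * g σ 0 z) (fun σ i => g σ i.succ) fun σ i => hg σ i.succ
    simp only [h]
    rw [circleIntegral.integral_fun_sum]
    · refine sum_congr rfl fun σ _ => ?_
      rw [← circleIntegral.integral_const_mul, mul_comm, ← circleIntegral.integral_const_mul]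
      exact congrArg (fun f => circleIntegral f 0 ρ) (funext fun z => by ring)
    · intro σ _
      have := (hg σ 0).const_fun_smul (a := c σ * ∏ i : Fin n, ∮ z in C(0, ρ), g σ i.succ z)
      refine (congrArg (CircleIntegrable · 0 ρ) (funext fun z => ?_)).mp this
      simp only [smul_eq_mul]
      ring

lemma prod_Ioi_sub_eq_det {R : Type*} [CommRing R] {n : ℕ} (z : Fin n → R) :
    ∏ j : Fin n, ∏ k ∈ Ioi j, (z j - z k) =
      (Matrix.of fun j k : Fin n => z j ^ (k.rev : ℕ)).det := by
  have h := Matrix.det_projVandermonde (fun _ => 1) z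
  simp only [one_mul] at h
  rw [← h]
  congr 1
  ext i j
  simp [Matrix.projVandermonde, Matrix.rectVandermonde]

lemma circIntN_prod_mul_vandermonde {ρ : ℝ} (n : ℕ) (f : Fin n → ℂ → ℂ)
    (hf : ∀ i k, CircleIntegrable (fun z => f i z * z ^ k) 0 ρ) :
    circIntN n ρ (fun z => (∏ j, f j (z j)) * ∏ j : Fin n, ∏ k ∈ Ioi j, (z j - z k)) =
      (Matrix.of fun j k : Fin n => ∮ z in C(0, ρ), f j.rev z * z ^ (k : ℕ)).det := by
  have h := circIntN_sum_prod (univ : Finset (Equiv.Perm (Fin n))) n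
    (fun σ => ((Equiv.Perm.sign σ : ℤ) : ℂ))
    (fun σ i z => f i z * z ^ ((σ i).rev : ℕ)) fun σ i => hf i _
  rw [← Matrix.det_submatrix_equiv_self Fin.revPerm, ← Matrix.det_transpose, Matrix.det_apply']
  simp only [Matrix.transpose_apply, Matrix.submatrix_apply, Matrix.of_apply, Fin.revPerm_apply,
    Fin.rev_rev]
  rw [← h]
  congr 1
  ext z
  rw [prod_Ioi_sub_eq_det, ← Matrix.det_transpose, Matrix.det_apply', mul_sum]
  refine sum_congr rfl fun σ _ => ?_
  simp only [Matrix.transpose_apply, Matrix.of_apply, prod_mul_distrib]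
  ring

section Integrals

variable {ρ : ℝ}

lemma one_sub_ne_zero_of_mem_closedBall (hρ : ρ < 1) {z : ℂ} (hz : z ∈ closedBall (0 : ℂ) ρ) :
    1 - z ≠ 0 := by
  intro h
  have : z = 1 := (sub_eq_zero.mp h).symm
  simp [this] at hz
  linarith

lemma ne_zero_of_mem_sphere_zero (hρ : 0 < ρ) {z : ℂ} (hz : z ∈ sphere (0 : ℂ) ρ) : z ≠ 0 :=
  ne_of_mem_sphere hz hρ.ne'

lemma circleIntegrable_weight (hρ : ρ ∈ Set.Ioo (0 : ℝ) 1) (α : ℂ) (n D a : ℕ) :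
    CircleIntegrable (fun z => (α * z + 1 - α) ^ n / (z ^ D * (1 - z) ^ a)) 0 ρ := by
  refine ContinuousOn.circleIntegrable hρ.1.le (ContinuousOn.div (by fun_prop) (by fun_prop) ?_)
  intro z hz
  exact mul_ne_zero (pow_ne_zero _ (ne_zero_of_mem_sphere_zero hρ.1 hz))
    (pow_ne_zero _ (one_sub_ne_zero_of_mem_closedBall hρ.2 (sphere_subset_closedBall hz)))

lemma circleIntegral_holomorphic_weight (hρ : ρ ∈ Set.Ioo (0 : ℝ) 1) (α : ℂ) (n m a : ℕ) :
    (∮ z in C(0, ρ), (α * z + 1 - α) ^ n / (1 - z) ^ a * z ^ m) = 0 := by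
  refine DiffContOnCl.circleIntegral_eq_zero hρ.1.le (DifferentiableOn.diffContOnCl ?_)
  rw [closure_ball _ hρ.1.ne']
  refine DifferentiableOn.mul (DifferentiableOn.div (by fun_prop) (by fun_prop) ?_) (by fun_prop)
  exact fun z hz => pow_ne_zero _ (one_sub_ne_zero_of_mem_closedBall hρ.2 hz)

lemma circleIntegral_pow_div_pow (hρ : 0 < ρ) (α : ℂ) (n d : ℕ) :
    (∮ z in C(0, ρ), (α * z + 1 - α) ^ n / z ^ (d + 1)) =
      2 * Real.pi * Complex.I * (α ^ d * (1 - α) ^ (n - d) * n.choose d) := by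
  have h1 : Set.EqOn (fun z : ℂ => (α * z + 1 - α) ^ n / z ^ (d + 1))
      (fun z => ∑ m ∈ range (n + 1), (α ^ m * (1 - α) ^ (n - m) * n.choose m) *
        (z - 0) ^ ((m : ℤ) - (d + 1))) (sphere 0 ρ) := by
    intro z hz
    have hz0 := ne_zero_of_mem_sphere_zero hρ hz
    simp only
    rw [add_sub_assoc, add_pow, sum_div]
    refine sum_congr rfl fun m _ => ?_
    rw [sub_zero, zpow_sub₀ hz0, mul_pow]
    norm_cast
    field_simp
  rw [circleIntegral.integral_congr hρ.le h1, circleIntegral.integral_fun_sum]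
  · simp only [circleIntegral.integral_const_mul]
    have h2 (m : ℕ) : (∮ z in C(0, ρ), (z - 0) ^ ((m : ℤ) - (d + 1))) =
        if m = d then 2 * Real.pi * Complex.I else 0 := by
      split_ifs with hm
      · subst hm
        rw [← circleIntegral.integral_sub_center_inv 0 hρ.ne']
        simp
      · exact circleIntegral.integral_sub_zpow_of_ne (by omega) _ _ _
    simp only [h2, mul_ite, mul_zero, sum_ite_eq', mem_range]
    split_ifs with hd
    · ring
    · rw [Nat.choose_eq_zero_of_lt (by omega)]
      simp
  · intro m _
    refine ContinuousOn.circleIntegrable hρ.le (continuousOn_const.mul ?_)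
    refine ContinuousOn.zpow₀ (by fun_prop) _ fun z hz => Or.inl ?_
    simpa using ne_zero_of_mem_sphere_zero hρ hz

lemma circleIntegral_weight_sub (hρ : ρ ∈ Set.Ioo (0 : ℝ) 1) (α : ℂ) (n D a : ℕ) :
    (∮ z in C(0, ρ), (α * z + 1 - α) ^ (n + 1) / (z ^ (D + 1) * (1 - z) ^ (a + 1))) =
      (∮ z in C(0, ρ), (α * z + 1 - α) ^ n / (z ^ D * (1 - z) ^ (a + 1))) +
      (1 - α) * ∮ z in C(0, ρ), (α * z + 1 - α) ^ n / (z ^ (D + 1) * (1 - z) ^ a) := by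
  rw [← sub_eq_iff_eq_add', ← circleIntegral.integral_sub (circleIntegrable_weight hρ ..)
    (circleIntegrable_weight hρ ..), ← circleIntegral.integral_const_mul]
  refine circleIntegral.integral_congr hρ.1.le fun z hz => ?_
  have hz0 := ne_zero_of_mem_sphere_zero hρ.1 hz
  have hz1 := one_sub_ne_zero_of_mem_closedBall hρ.2 (sphere_subset_closedBall hz)
  field_simp
  ring

lemma circleIntegral_weight (hρ : ρ ∈ Set.Ioo (0 : ℝ) 1) (α : ℂ) (Q D i : ℕ) :
    (∮ z in C(0, ρ), (α * z + 1 - α) ^ (Q + D + i) / (z ^ D * (1 - z) ^ (i + 1))) =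
      2 * Real.pi * Complex.I * ((1 - α) ^ (Q + i + 1) *
        ∑ m ∈ range D, ((D - 1 - m + i).choose i : ℂ) * ((m + Q).choose Q : ℂ) * α ^ m) := by
  induction i generalizing D with
  | zero =>
    induction D with
    | zero => simpa using circleIntegral_holomorphic_weight hρ α Q 0 1
    | succ D ih =>
      have h := circleIntegral_weight_sub hρ α (Q + D) D 0
      have h' := circleIntegral_pow_div_pow hρ.1 α (Q + D) D
      simp only [zero_add, pow_zero, mul_one, add_zero, Nat.choose_zero_right, Nat.cast_one,
        one_mul] at h ih h' ⊢
      rw [← add_assoc, h, ih, h', sum_range_succ, Nat.add_sub_cancel, add_comm D Q,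
        Nat.choose_symm_add]
      ring
  | succ i ihi =>
    induction D with
    | zero => simpa using circleIntegral_holomorphic_weight hρ α (Q + (i + 1)) 0 (i + 1 + 1)
    | succ D ih =>
      have h := circleIntegral_weight_sub hρ α (Q + D + (i + 1)) D (i + 1)
      have h' := ihi (D + 1)
      rw [show Q + (D + 1) + i = Q + D + (i + 1) by ring] at h'
      rw [show Q + (D + 1) + (i + 1) = Q + D + (i + 1) + 1 by ring, h, ih, h']
      have key : ∑ m ∈ range (D + 1), ((D + 1 - 1 - m + (i + 1)).choose (i + 1) : ℂ) *
            ((m + Q).choose Q : ℂ) * α ^ m =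
          ∑ m ∈ range D, ((D - 1 - m + (i + 1)).choose (i + 1) : ℂ) *
            ((m + Q).choose Q : ℂ) * α ^ m +
          ∑ m ∈ range (D + 1), ((D + 1 - 1 - m + i).choose i : ℂ) *
            ((m + Q).choose Q : ℂ) * α ^ m := by
        simp only [sum_range_succ _ D]
        conv_rhs => rw [← add_assoc, ← sum_add_distrib]
        congr 1
        · refine sum_congr rfl fun m hm => ?_
          have hm := mem_range.mp hm
          obtain ⟨e, rfl⟩ : ∃ e, D = m + 1 + e := ⟨D - (m + 1), by omega⟩
          rw [show m + 1 + e + 1 - 1 - m + (i + 1) = (e + i + 1) + 1 by omega,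
            show m + 1 + e - 1 - m + (i + 1) = e + i + 1 by omega,
            show m + 1 + e + 1 - 1 - m + i = e + i + 1 by omega, Nat.choose_succ_succ]
          push_cast
          ring
        · simp
      rw [key]
      ring

end Integrals

lemma det_sum_monic_mul_monic {R : Type*} [CommRing R] {n : ℕ} {ι : Type*} (S : Finset ι)
    (w x : ι → R) (p π : Fin n → Polynomial R)
    (hp : ∀ i, (p i).natDegree = i) (hpm : ∀ i, (p i).Monic)
    (hπ : ∀ i, (π i).natDegree = i) (hπm : ∀ i, (π i).Monic) :
    (Matrix.of fun j k : Fin n => ∑ m ∈ S, w m * (p j).eval (x m) * (π k).eval (x m)).det =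
      (Matrix.of fun j k : Fin n => ∑ m ∈ S, w m * x m ^ ((j : ℕ) + (k : ℕ))).det := by
  have h : (Matrix.of fun j k : Fin n => ∑ m ∈ S, w m * (p j).eval (x m) * (π k).eval (x m)) =
      (Matrix.of fun i j : Fin n => (p j).coeff i).transpose *
      (Matrix.of fun j k : Fin n => ∑ m ∈ S, w m * x m ^ ((j : ℕ) + (k : ℕ))) *
      (Matrix.of fun i j : Fin n => (π j).coeff i) := by
    ext j k
    have e (P : Polynomial R) (l : Fin n) (hP : P.natDegree = l) (y : R) :
        P.eval y = ∑ i : Fin n, P.coeff i * y ^ (i : ℕ) := by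
      rw [Polynomial.eval_eq_sum_range' (n := n) (by omega), Finset.sum_range]
    simp only [Matrix.of_apply, Matrix.mul_apply, Matrix.transpose_apply, sum_mul, mul_sum,
      e _ _ (hp _), e _ _ (hπ _)]
    rw [sum_comm]
    refine sum_congr rfl fun a _ => ?_
    rw [sum_comm]
    refine sum_congr rfl fun b _ => sum_congr rfl fun m _ => ?_
    ring
  rw [h, Matrix.det_mul, Matrix.det_mul, Matrix.det_transpose,
    Matrix.det_matrixOfPolynomials p hp hpm, Matrix.det_matrixOfPolynomials π hπ hπm]
  simp

lemma gefp_eq_det_s2 (N s : ℕ) (α : ℝ) (rv : Fin s → ℕ) {ρ : ℝ} (hρ : ρ ∈ Set.Ioo (0 : ℝ) 1) :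
    gefp N s α rv ρ = (-1 : ℂ) ^ s * ((2 * Real.pi * Complex.I) ^ s)⁻¹ *
      (Matrix.of fun i k : Fin s => ∮ z in C(0, ρ),
        ((α : ℂ) * z + 1 - α) ^ (N - 1 - (i.rev : ℕ)) /
          (z ^ rv i.rev * (z - 1) ^ ((i : ℕ) + 1)) * z ^ (k : ℕ)).det := by
  unfold gefp
  congr 1
  rw [circIntN_prod_mul_vandermonde s (fun j z => ((α : ℂ) * z + 1 - α) ^ (N - 1 - (j : ℕ)) /
    (z ^ rv j * (z - 1) ^ (s - (j : ℕ))))]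
  · congr! 10 with i k
    rw [Fin.val_rev]; omega
  · intro j k
    refine ContinuousOn.circleIntegrable hρ.1.le
      (ContinuousOn.mul (ContinuousOn.div (by fun_prop) (by fun_prop) ?_) (by fun_prop))
    intro z hz
    refine mul_ne_zero (pow_ne_zero _ (ne_zero_of_mem_sphere_zero hρ.1 hz)) (pow_ne_zero _ ?_)
    rw [← neg_ne_zero, neg_sub]
    exact one_sub_ne_zero_of_mem_closedBall hρ.2 (sphere_subset_closedBall hz)

lemma neg_one_pow_mul_one_sub_pow {R : Type*} [CommRing R] (z : R) (n : ℕ) :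
    (-1) ^ n * (1 - z) ^ n = (z - 1) ^ n := by
  rw [← mul_pow]
  ring

lemma div_neg_one_pow {K : Type*} [Field K] (x : K) (n : ℕ) : x / (-1) ^ n = (-1) ^ n * x := by
  rw [div_eq_mul_inv, ← inv_pow, inv_neg_one, mul_comm]

lemma gefp_eq_zero {N s : ℕ} (α : ℝ) (rv : Fin s → ℕ) {ρ : ℝ} (hρ : ρ ∈ Set.Ioo (0 : ℝ) 1)
    (hs : 0 < s) (h0 : rv ⟨0, hs⟩ = 0) : gefp N s α rv ρ = 0 := by
  rw [gefp_eq_det_s2 N s α rv hρ, Matrix.det_eq_zero_of_row_eq_zero (Fin.rev ⟨0, hs⟩), mul_zero]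
  intro k
  simp only [Matrix.of_apply, Fin.rev_rev, h0, pow_zero, one_mul]
  refine Eq.trans ?_ <| (congrArg ((-1 : ℂ) ^ ((Fin.rev ⟨0, hs⟩ : Fin s) + 1 : ℕ) * ·)
    (circleIntegral_holomorphic_weight hρ (α : ℂ) (N - 1) k
      ((Fin.rev ⟨0, hs⟩ : Fin s) + 1))).trans (mul_zero _)
  rw [← circleIntegral.integral_const_mul]
  refine circleIntegral.integral_congr hρ.1.le fun z _ => ?_
  simp only [← neg_one_pow_mul_one_sub_pow, tsub_zero]
  rw [div_mul_eq_div_div, div_neg_one_pow]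
  ring

lemma bgf_one (N r s : ℕ) (α : ℝ) {ρ : ℝ} (hρ : ρ ∈ Set.Ioo (0 : ℝ) 1) (hs : 0 < s) :
    bgf N r s α ρ 1 = gefp N s α (fun _ => r) ρ := by
  have h (n : ℕ) : ∑ r1 ∈ Finset.Icc 1 n,
      (gefp N s α (fun j => if (j : ℕ) = 0 then r1 else r) ρ -
        gefp N s α (fun j => if (j : ℕ) = 0 then r1 - 1 else r) ρ) =
      gefp N s α (fun j => if (j : ℕ) = 0 then n else r) ρ -
        gefp N s α (fun j => if (j : ℕ) = 0 then 0 else r) ρ := by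
    induction n with
    | zero => simp
    | succ n ih => rw [sum_Icc_succ_top (by omega), ih, Nat.add_sub_cancel]; ring
  simp only [bgf, Complex.ofReal_one, one_pow, mul_one]
  rw [h, gefp_eq_zero (N := N) α (fun j => if (j : ℕ) = 0 then 0 else r) hρ hs (by simp)]
  simp

lemma choose_eq_descPochhammer_comp {r m : ℕ} (hm : m < r) (i : ℕ) :
    ((r - 1 - m + i).choose i : ℂ) = (-1) ^ i / (i.factorial : ℂ) *
      ((descPochhammer ℂ i).comp (Polynomial.X - Polynomial.C (r : ℂ))).eval (m : ℂ) := by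
  obtain ⟨e, rfl⟩ : ∃ e, r = m + 1 + e := ⟨r - (m + 1), by omega⟩
  have h1 : (descPochhammer ℂ i).eval (-((e + 1 : ℕ) : ℂ)) =
      (-1) ^ i * (ascPochhammer ℂ i).eval ((e + 1 : ℕ) : ℂ) := by
    rw [← neg_neg ((e + 1 : ℕ) : ℂ), ascPochhammer_eval_neg_eq_descPochhammer, ← mul_assoc,
      ← mul_pow]
    simp
  have h2 : ((m : ℂ) - ((m + 1 + e : ℕ) : ℂ)) = -((e + 1 : ℕ) : ℂ) := by push_cast; ring
  rw [show m + 1 + e - 1 - m + i = e + i by omega, Polynomial.eval_comp, Polynomial.eval_sub,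
    Polynomial.eval_X, Polynomial.eval_C, h2, h1, ← Nat.cast_ascFactorial,
    Nat.ascFactorial_eq_factorial_mul_choose]
  push_cast
  have := Nat.cast_ne_zero (R := ℂ).mpr i.factorial_ne_zero
  field_simp
  rw [← pow_mul, mul_comm i 2, pow_mul]
  simp

lemma choose_add_eq_descPochhammer (q m k : ℕ) :
    ((m + q).choose (q + k) : ℂ) = (q.factorial : ℂ) / ((q + k).factorial : ℂ) *
      ((m + q).choose q : ℂ) * (descPochhammer ℂ k).eval (m : ℂ) := by
  rw [descPochhammer_eval_eq_descFactorial]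
  have h3 : (m + q).choose (q + k) * (q + k).factorial =
      q.factorial * (m + q).choose q * m.descFactorial k := by
    rw [mul_comm, ← Nat.descFactorial_eq_factorial_mul_choose,
      ← Nat.descFactorial_eq_factorial_mul_choose, ← Nat.descFactorial_mul_descFactorial
        (Nat.le_add_right q k), Nat.add_sub_cancel, Nat.add_sub_cancel_left, mul_comm]
  have := Nat.cast_ne_zero (R := ℂ).mpr (q + k).factorial_ne_zero
  field_simp
  exact_mod_cast h3

lemma entry_eq {N r s q : ℕ} (hN : N = q + r + s) {α : ℂ} (hα : α ≠ 0) {ρ : ℝ}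
    (hρ : ρ ∈ Set.Ioo (0 : ℝ) 1) (i k : Fin s) :
    (∮ z in C(0, ρ), (α * z + 1 - α) ^ (N - 1 - (i.rev : ℕ)) /
        (z ^ r * (z - 1) ^ ((i : ℕ) + 1)) * z ^ (k : ℕ)) =
      -(2 * Real.pi * Complex.I * (1 - α) ^ (q + i + 1) / ((i : ℕ).factorial : ℂ)) *
      (((1 - α) ^ (k : ℕ) * (q.factorial : ℂ) / ((q + k).factorial * α ^ (k : ℕ))) *
      ∑ m ∈ range r, ((m + q).choose q * α ^ m) *
        ((descPochhammer ℂ i).comp (Polynomial.X - Polynomial.C (r : ℂ))).eval (m : ℂ) *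
        (descPochhammer ℂ k).eval (m : ℂ)) := by
  have hsign : (∮ z in C(0, ρ), (α * z + 1 - α) ^ (N - 1 - (i.rev : ℕ)) /
        (z ^ r * (z - 1) ^ ((i : ℕ) + 1)) * z ^ (k : ℕ)) = (-1) ^ ((i : ℕ) + 1) *
      ∮ z in C(0, ρ), (α * z + 1 - α) ^ (q + r + i) /
        (z ^ r * (1 - z) ^ ((i : ℕ) + 1)) * z ^ (k : ℕ) := by
    rw [← circleIntegral.integral_const_mul, Fin.val_rev,
      show N - 1 - (s - ((i : ℕ) + 1)) = q + r + i by omega]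
    refine circleIntegral.integral_congr hρ.1.le fun z _ => ?_
    simp only [← neg_one_pow_mul_one_sub_pow]
    rw [mul_left_comm, div_mul_eq_div_div, div_neg_one_pow]
    ring
  rw [hsign]
  obtain hk | hk := le_total (k : ℕ) r
  · obtain ⟨D, rfl⟩ := Nat.exists_eq_add_of_le' hk
    have hI : (∮ z in C(0, ρ), (α * z + 1 - α) ^ (q + (D + k) + i) /
        (z ^ (D + k : ℕ) * (1 - z) ^ ((i : ℕ) + 1)) * z ^ (k : ℕ)) =
        ∮ z in C(0, ρ), (α * z + 1 - α) ^ ((q + k) + D + i) /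
        (z ^ D * (1 - z) ^ ((i : ℕ) + 1)) := by
      refine circleIntegral.integral_congr hρ.1.le fun z hz => ?_
      have hz0 := ne_zero_of_mem_sphere_zero hρ.1 hz
      have hz1 := one_sub_ne_zero_of_mem_closedBall hρ.2 (sphere_subset_closedBall hz)
      rw [show q + (D + k) + i = q + k + D + i by ring]
      field_simp
      ring
    have hS : ∑ m ∈ range (D + k), ((m + q).choose q * α ^ m) *
        ((descPochhammer ℂ i).comp
          (Polynomial.X - Polynomial.C ((D + k : ℕ) : ℂ))).eval (m : ℂ) *
        (descPochhammer ℂ k).eval (m : ℂ) =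
        (-1) ^ (i : ℕ) * ((i : ℕ).factorial : ℂ) * ((q + k).factorial / (q.factorial : ℂ)) *
          α ^ (k : ℕ) * ∑ m ∈ range D, ((D - 1 - m + i).choose i : ℂ) *
            ((m + (q + k)).choose (q + k) : ℂ) * α ^ m := by
      rw [add_comm D, sum_range_add]
      rw [sum_eq_zero, zero_add, mul_sum]
      · refine sum_congr rfl fun m hm => ?_
        have hm := mem_range.mp hm
        have e1 := choose_eq_descPochhammer_comp (show k + m < k + D by omega) (i : ℕ)
        have e2 := choose_add_eq_descPochhammer q (k + m) k
        rw [show k + D - 1 - (k + m) + i = D - 1 - m + i by omega] at e1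
        rw [show k + m + q = m + (q + k) by ring] at e2 ⊢
        rw [e1, e2]
        have h1 := Nat.cast_ne_zero (R := ℂ).mpr (q + k).factorial_ne_zero
        have h2 := Nat.cast_ne_zero (R := ℂ).mpr q.factorial_ne_zero
        have h3 := Nat.cast_ne_zero (R := ℂ).mpr (i : ℕ).factorial_ne_zero
        field_simp
        rw [← pow_mul, mul_comm (i : ℕ) 2, pow_mul]
        ring
      · intro m hm
        rw [descPochhammer_eval_eq_descFactorial,
          Nat.descFactorial_of_lt (mem_range.mp hm)]
        simp
    rw [hI, circleIntegral_weight hρ, hS]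
    have h1 := Nat.cast_ne_zero (R := ℂ).mpr (q + k).factorial_ne_zero
    have h2 := Nat.cast_ne_zero (R := ℂ).mpr q.factorial_ne_zero
    have h3 := Nat.cast_ne_zero (R := ℂ).mpr (i : ℕ).factorial_ne_zero
    field_simp
    ring
  · obtain ⟨e, he⟩ := Nat.exists_eq_add_of_le hk
    have hI : (∮ z in C(0, ρ), (α * z + 1 - α) ^ (q + r + i) /
        (z ^ r * (1 - z) ^ ((i : ℕ) + 1)) * z ^ (k : ℕ)) =
        ∮ z in C(0, ρ), (α * z + 1 - α) ^ (q + r + i) / (1 - z) ^ ((i : ℕ) + 1) * z ^ e := by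
      refine circleIntegral.integral_congr hρ.1.le fun z hz => ?_
      have hz0 := ne_zero_of_mem_sphere_zero hρ.1 hz
      simp only [he]
      rw [pow_add z r e]
      field_simp
    rw [hI, circleIntegral_holomorphic_weight hρ, sum_eq_zero]
    · simp
    · intro m hm
      rw [descPochhammer_eval_eq_descFactorial,
        Nat.descFactorial_of_lt ((mem_range.mp hm).trans_le hk)]
      simp

lemma prod_prefactor (s q : ℕ) {t α : ℂ} (ht : t ≠ 0) (β : ℂ) :
    (-1) ^ s * (t ^ s)⁻¹ * (∏ i ∈ range s, -(t * β ^ (q + i + 1) / (i.factorial : ℂ))) *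
        ∏ i ∈ range s, β ^ i * (q.factorial : ℂ) / ((q + i).factorial * α ^ i) =
      ((q.factorial : ℂ) ^ s /
          ∏ j ∈ range s, (((q + j).factorial : ℂ) * (j.factorial : ℂ))) *
        β ^ (s * (s + q)) * (α ^ (s * (s - 1) / 2))⁻¹ := by
  rw [← sum_range_id, ← prod_pow_eq_pow_sum]
  induction s with
  | zero => simp
  | succ s ih =>
    simp only [prod_range_succ, pow_succ (-1 : ℂ), pow_succ t, pow_succ (q.factorial : ℂ), mul_inv]
    rw [show (s + 1) * (s + 1 + q) = s * (s + q) + (q + s + 1) + s by ring, pow_add, pow_add]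
    set A := ∏ i ∈ range s, -(t * β ^ (q + i + 1) / (i.factorial : ℂ))
    set B := ∏ i ∈ range s, β ^ i * (q.factorial : ℂ) / ((q + i).factorial * α ^ i)
    set c := β ^ (q + s + 1) * β ^ s * q.factorial /
      (((q + s).factorial : ℂ) * s.factorial * α ^ s)
    linear_combination c * ih +
      (-1) ^ s * (t ^ s)⁻¹ * A * B * c * mul_inv_cancel₀ ht

/-- Moment-determinant formula at `w = 1`:
`F_{N,r,s}(1) = [(q!)^s / ∏_{j=0}^{s−1}((q+j)!·j!)] (1−α)^{s(s+q)} α^{−s(s−1)/2}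
  · det[ Σ_{m=0}^{r−1} C(m+q,q) m^{j+k−2} α^m ]_{j,k=1,…,s}` with `q = N−r−s`. -/
theorem moment_det_formula_at_w_eq_one
    (N r s q : ℕ) (hr : 0 < r) (hs : 0 < s) (hN : r + s ≤ N) (hq : q = N - r - s)
    (α : ℝ) (hα : α ∈ Set.Ioo (0 : ℝ) 1)
    (ρG : ℝ) (hρG : ρG ∈ Set.Ioo (0 : ℝ) 1) :
    bgf N r s α ρG 1 =
      ((q.factorial : ℂ) ^ s /
          ∏ j ∈ Finset.range s, (((q + j).factorial : ℂ) * (j.factorial : ℂ))) *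
        (1 - (α : ℂ)) ^ (s * (s + q)) * ((α : ℂ) ^ (s * (s - 1) / 2))⁻¹ *
        Matrix.det (Matrix.of fun j k : Fin s =>
          ∑ m ∈ Finset.range r,
            ((m + q).choose q : ℂ) * (m : ℂ) ^ ((j : ℕ) + (k : ℕ)) * (α : ℂ) ^ m) := by
  have hα0 : (α : ℂ) ≠ 0 := by exact_mod_cast hα.1.ne'
  rw [bgf_one N r s α hρG hs, gefp_eq_det_s2 N s α _ hρG]
  simp only [entry_eq (show N = q + r + s by omega) hα0 hρG]
  have hdet := det_sum_monic_mul_monic (range r)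
    (fun m => ((m + q).choose q : ℂ) * (α : ℂ) ^ m) (fun m => (m : ℂ))
    (fun i : Fin s => (descPochhammer ℂ i).comp (Polynomial.X - Polynomial.C (r : ℂ)))
    (fun k : Fin s => descPochhammer ℂ k)
    (fun i => by rw [Polynomial.natDegree_comp, descPochhammer_natDegree,
      Polynomial.natDegree_X_sub_C, mul_one]) (fun i => (monic_descPochhammer ℂ i).comp_X_sub_C _)
    (fun k => descPochhammer_natDegree ℂ k) (fun k => monic_descPochhammer ℂ k)
  have hrow := Matrix.det_mul_row (fun k : Fin s =>
    (1 - (α : ℂ)) ^ (k : ℕ) * (q.factorial : ℂ) / ((q + k).factorial * (α : ℂ) ^ (k : ℕ)))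
    (Matrix.of fun i k : Fin s => ∑ m ∈ range r, ((m + q).choose q * (α : ℂ) ^ m) *
        ((descPochhammer ℂ i).comp (Polynomial.X - Polynomial.C (r : ℂ))).eval (m : ℂ) *
        (descPochhammer ℂ k).eval (m : ℂ))
  have hcol := Matrix.det_mul_column (fun i : Fin s =>
    -(2 * Real.pi * Complex.I * (1 - (α : ℂ)) ^ (q + i + 1) / ((i : ℕ).factorial : ℂ)))
    (Matrix.of fun i k : Fin s => (1 - (α : ℂ)) ^ (k : ℕ) * (q.factorial : ℂ) /
      ((q + k).factorial * (α : ℂ) ^ (k : ℕ)) *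
      ∑ m ∈ range r, ((m + q).choose q * (α : ℂ) ^ m) *
        ((descPochhammer ℂ i).comp (Polynomial.X - Polynomial.C (r : ℂ))).eval (m : ℂ) *
        (descPochhammer ℂ k).eval (m : ℂ))
  simp only [Matrix.of_apply] at hrow hcol
  rw [hcol, hrow, hdet]
  simp only [mul_right_comm _ ((α : ℂ) ^ _) ((_ : ℂ) ^ _)]
  rw [← mul_assoc, ← mul_assoc, ← prod_prefactor s q Complex.two_pi_I_ne_zero (1 - (α : ℂ)),
    prod_range, prod_range]
end

section
/- Existence and uniqueness of the log-gas parameter η in Regime II. Let α ∈ (0,1), Q ≥ 0, and let R satisfy 1 ≤ R < R_c, where R_c = (1+√(α(1+Q)))^2/(1−α). Then there exists a unique η ∈ (0,1) such that α·(1+η)^2·(1+Q+Rη)·(1+(R+Q)η) = (1−η)^2·(1+Rη)·(1+Q+(R+Q)η). -/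
/-- Cross-multiplied form of the fact that
`(1-η)(1+Rη)(1+Q+(R+Q)η) / ((1+η)(1+Q+Rη)(1+(R+Q)η))` is strictly decreasing on `[0,1]`. -/
lemma eta_ratio_cross_lt {Q R x y : ℝ} (hQ : 0 ≤ Q) (hR : 0 ≤ R) (hx : 0 ≤ x) (hxy : x < y)
    (hy : y ≤ 1) :
    ((1 - y) * (1 + x)) * (((1 + R * y) * (1 + Q + (R + Q) * y)) *
        ((1 + Q + R * x) * (1 + (R + Q) * x))) <
      ((1 - x) * (1 + y)) * (((1 + R * x) * (1 + Q + (R + Q) * x)) *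
        ((1 + Q + R * y) * (1 + (R + Q) * y))) := by
  have hy0 : 0 ≤ y := hx.trans hxy.le
  have hS : 0 ≤ R + Q := add_nonneg hR hQ
  have hxy1 : x * y ≤ 1 := mul_le_one₀ (hxy.le.trans hy) hy0 hy
  have hxy0 : 0 ≤ x * y := mul_nonneg hx hy0
  have lower : Q ^ 2 * (R * (R + Q) * (x * y)) <
      (1 + R * x) * (1 + Q + (R + Q) * x) * ((1 + Q + R * y) * (1 + (R + Q) * y)) := by
    have h1 : R * x * ((R + Q) * y) < (1 + R * x) * (1 + (R + Q) * y) := by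
      nlinarith [mul_nonneg hR hx, mul_nonneg hS hy0]
    have h2 : Q ^ 2 ≤ (1 + Q + (R + Q) * x) * (1 + Q + R * y) := by
      rw [sq]
      have := mul_nonneg hS hx
      have := mul_nonneg hR hy0
      gcongr <;> linarith
    have h3 : 0 < (1 + Q + (R + Q) * x) * (1 + Q + R * y) := by positivity
    calc Q ^ 2 * (R * (R + Q) * (x * y)) = Q ^ 2 * (R * x * ((R + Q) * y)) := by ring
      _ ≤ (1 + Q + (R + Q) * x) * (1 + Q + R * y) * (R * x * ((R + Q) * y)) := by gcongr
      _ < (1 + Q + (R + Q) * x) * (1 + Q + R * y) * ((1 + R * x) * (1 + (R + Q) * y)) := by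
        gcongr
      _ = _ := by ring
  have upper : 0 ≤ (1 + R * y) * (1 + Q + (R + Q) * y) *
      ((1 + Q + R * x) * (1 + (R + Q) * x)) := by positivity
  have main : 0 < (1 - x * y) * (Q ^ 2 * (1 + Q - R * (R + Q) * (x * y))) +
      (1 + R * x) * (1 + Q + (R + Q) * x) * ((1 + Q + R * y) * (1 + (R + Q) * y)) +
      (1 + R * y) * (1 + Q + (R + Q) * y) * ((1 + Q + R * x) * (1 + (R + Q) * x)) := by
    have h1 : 0 ≤ (1 - x * y) * (Q ^ 2 * (1 + Q)) :=
      mul_nonneg (sub_nonneg.2 hxy1) (by positivity)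
    have h2 : 0 ≤ x * y * (Q ^ 2 * (R * (R + Q) * (x * y))) := by positivity
    linarith
  linarith [mul_pos (sub_pos.2 hxy) main]

/-- No two distinct points of `(0,1)` solve the quartic equation with the same `α`. -/
lemma not_lt_of_eta_eq {α Q R x y : ℝ} (hQ : 0 ≤ Q) (hR : 0 ≤ R)
    (hx : 0 < x) (hy : y < 1)
    (ex : α * (1 + x) ^ 2 * (1 + Q + R * x) * (1 + (R + Q) * x) =
      (1 - x) ^ 2 * (1 + R * x) * (1 + Q + (R + Q) * x))
    (ey : α * (1 + y) ^ 2 * (1 + Q + R * y) * (1 + (R + Q) * y) =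
      (1 - y) ^ 2 * (1 + R * y) * (1 + Q + (R + Q) * y)) : ¬ x < y := by
  intro hxy
  have hy0 : 0 < y := hx.trans hxy
  have cross := eta_ratio_cross_lt hQ hR hx.le hxy hy.le
  have base : (1 - y) * (1 + x) < (1 - x) * (1 + y) := by linarith
  have hy1 : 0 < 1 - y := sub_pos.2 hy
  have prod := mul_lt_mul'' base cross (by positivity) (by positivity)
  refine prod.ne ?_
  linear_combination (-(1 + x) ^ 2 * (1 + Q + R * x) * (1 + (R + Q) * x)) * ey +
    ((1 + y) ^ 2 * (1 + Q + R * y) * (1 + (R + Q) * y)) * ex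


/-- Existence and uniqueness of the log-gas parameter `η` in Regime II: for
`α ∈ (0,1)`, `Q ≥ 0` and `1 ≤ R < R_c = (1+√(α(1+Q)))²/(1−α)`, there is a
unique `η ∈ (0,1)` with
`α(1+η)²(1+Q+Rη)(1+(R+Q)η) = (1−η)²(1+Rη)(1+Q+(R+Q)η)`. -/
theorem exists_unique_eta_regimeII
    (α Q R : ℝ) (hα : α ∈ Set.Ioo (0 : ℝ) 1) (hQ : 0 ≤ Q)
    (hR1 : 1 ≤ R) (hRc : R < (1 + Real.sqrt (α * (1 + Q))) ^ 2 / (1 - α)) :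
    ∃! η : ℝ, η ∈ Set.Ioo (0 : ℝ) 1 ∧
      α * (1 + η) ^ 2 * (1 + Q + R * η) * (1 + (R + Q) * η) =
        (1 - η) ^ 2 * (1 + R * η) * (1 + Q + (R + Q) * η) := by
  obtain ⟨hα0, hα1⟩ := hα
  have hR : 0 ≤ R := zero_le_one.trans hR1
  let f : ℝ → ℝ := fun η => α * (1 + η) ^ 2 * (1 + Q + R * η) * (1 + (R + Q) * η) -
    (1 - η) ^ 2 * (1 + R * η) * (1 + Q + (R + Q) * η)
  have hf : ContinuousOn f (Set.Icc 0 1) := by fun_prop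
  have h0 : f 0 < 0 := by
    simp only [f]
    nlinarith [mul_pos (sub_pos.2 hα1) (by linarith : 0 < 1 + Q)]
  have h1 : 0 < f 1 := by
    have : f 1 = α * (1 + 1) ^ 2 * (1 + Q + R) * (1 + (R + Q)) := by simp only [f]; ring
    rw [this]
    positivity
  obtain ⟨η, hη, hfη⟩ := intermediate_value_Ioo zero_le_one hf ⟨h0, h1⟩
  have eη := sub_eq_zero.1 hfη
  refine ⟨η, ⟨hη, eη⟩, ?_⟩
  rintro y ⟨hy, ey⟩
  exact le_antisymm (not_lt.1 (not_lt_of_eta_eq hQ hR hη.1 hy.2 eη ey))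
    (not_lt.1 (not_lt_of_eta_eq hQ hR hy.1 hη.2 ey eη))
end
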